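/- The operator 𝒮 satisfies the Zamolodchikov tetrahedron equation: on F^{⊗6}, 𝒮₃₅₆ 𝒮₂₄₆ 𝒮₁₄₅ 𝒮₁₂₃ = 𝒮₁₂₃ 𝒮₁₄₅ 𝒮₂₄₆ 𝒮₃₅₆, where 𝒮_{abc} denotes 𝒮 acting on the tensor factors in positions a,b,c and as the identity on the other factors. -/

import Mathlib

open TensorProduct

noncomputable section

abbrev Fq : Type := RatFunc ℚ

def q : Fq := RatFunc.X

abbrev F : Type := ℕ →₀ Fq

def ket (m : ℕ) : F := Finsupp.single m 1

/-- Linear operator on the Fock space from its action on the basis. -/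
def opOf (v : ℕ → F) : F →ₗ[Fq] F := Finsupp.lift F Fq ℕ v

/-- q²-oscillator K -/
def K2 : F →ₗ[Fq] F := opOf fun m => q ^ (2 * m) • ket m
/-- q²-oscillator A⁺ -/
def Ap : F →ₗ[Fq] F := opOf fun m => ket (m + 1)
/-- q²-oscillator A⁻ -/
def Am : F →ₗ[Fq] F := opOf fun m => (1 - q ^ (4 * m)) • ket (m - 1)
/-- q-oscillator k -/
def kk : F →ₗ[Fq] F := opOf fun m => q ^ m • ket m
/-- q-oscillator a⁺ -/
def ap : F →ₗ[Fq] F := opOf fun m => ket (m + 1)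
/-- q-oscillator a⁻ -/
def am : F →ₗ[Fq] F := opOf fun m => (1 - q ^ (2 * m)) • ket (m - 1)

def pi1 (α β μ ν κ σ : Fq) : Matrix (Fin 7) (Fin 7) (F →ₗ[Fq] F) :=
  !![μ • Am, α • K2, 0, 0, 0, 0, 0;
     β • K2, ν • Ap, 0, 0, 0, 0, 0;
     0, 0, κ • LinearMap.id, 0, 0, 0, 0;
     0, 0, 0, σ • LinearMap.id, 0, 0, 0;
     0, 0, 0, 0, κ⁻¹ • LinearMap.id, 0, 0;
     0, 0, 0, 0, 0, ν⁻¹ • Am, (q ^ 2 * β⁻¹) • K2;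
     0, 0, 0, 0, 0, (q ^ 2 * α⁻¹) • K2, μ⁻¹ • Ap]

def pi2 (α β μ ν κ σ : Fq) : Matrix (Fin 7) (Fin 7) (F →ₗ[Fq] F) :=
  !![κ • LinearMap.id, 0, 0, 0, 0, 0, 0;
     0, μ • Am, α • K2, 0, 0, 0, 0;
     0, β • K2, ν • Ap, 0, 0, 0, 0;
     0, 0, 0, σ • LinearMap.id, 0, 0, 0;
     0, 0, 0, 0, ν⁻¹ • Am, (q ^ 2 * β⁻¹) • K2, 0;
     0, 0, 0, 0, (q ^ 2 * α⁻¹) • K2, μ⁻¹ • Ap, 0;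
     0, 0, 0, 0, 0, 0, κ⁻¹ • LinearMap.id]

def pi3 (α μ κa κb : Fq) : Matrix (Fin 7) (Fin 7) (F →ₗ[Fq] F) :=
  !![κa • LinearMap.id, 0, 0, 0, 0, 0, 0;
     0, κb • LinearMap.id, 0, 0, 0, 0, 0;
     0, 0, μ • (am ∘ₗ am), α • (kk ∘ₗ am), (-((1 + q ^ 2) * μ)⁻¹ * α ^ 2) • (kk ∘ₗ kk), 0, 0;
     0, 0, (-(1 + q ^ 2) * α⁻¹ * μ) • (am ∘ₗ kk), am ∘ₗ ap - kk ∘ₗ kk, (-(q * μ)⁻¹ * α) • (kk ∘ₗ ap), 0, 0;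
     0, 0, (-(1 + q ^ 2) * q ^ 2 * α⁻¹ ^ 2 * μ) • (kk ∘ₗ kk), ((1 + q ^ 2) * α⁻¹) • (kk ∘ₗ ap), μ⁻¹ • (ap ∘ₗ ap), 0, 0;
     0, 0, 0, 0, 0, κb⁻¹ • LinearMap.id, 0;
     0, 0, 0, 0, 0, 0, κa⁻¹ • LinearMap.id]

def rhoB : Fin 7 → ℤ := ![5, 3, 1, 0, -1, -3, -5]

def CB : Matrix (Fin 7) (Fin 7) Fq := fun i j => if (i : ℕ) + (j : ℕ) = 6 then q ^ rhoB j else 0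

/-- `(p)_n` for an integer `n`: `∏_{l=1}^{n}(1-p^l)` if `n ≥ 0`, and `0` if `n < 0`
(the latter convention makes the q-multinomial bracket below vanish, via multiplication
for a numerator index and via division by zero for a denominator index, whenever some
index is negative, as required). -/
def qfac (p : Fq) (n : ℤ) : Fq :=
  if 0 ≤ n then ∏ l ∈ Finset.range n.toNat, (1 - p ^ (l + 1)) else 0

/-- The matrix element 𝒮^{abc}_{ijk} (with λ = b - μ in the sum over λ + μ = b). -/
def Scoef (a b c i j k : ℕ) : Fq :=
  (if i + j = a + b then 1 else 0) * (if j + k = b + c then 1 else 0) *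
    ∑ μ ∈ Finset.range (b + 1),
      (-1 : Fq) ^ (b - μ) *
        q ^ (2 * (i : ℤ) * ((c : ℤ) - (j : ℤ)) + 2 * ((k : ℤ) + 1) * ((b : ℤ) - (μ : ℤ))
          + 2 * (μ : ℤ) * ((μ : ℤ) - (k : ℤ))) *
        ((qfac (q ^ 4) (i : ℤ) * qfac (q ^ 4) (j : ℤ) * qfac (q ^ 4) ((c : ℤ) + (μ : ℤ))) /
          (qfac (q ^ 4) (μ : ℤ) * qfac (q ^ 4) ((b : ℤ) - (μ : ℤ)) *
            qfac (q ^ 4) ((i : ℤ) - (μ : ℤ)) * qfac (q ^ 4) ((j : ℤ) - ((b : ℤ) - (μ : ℤ))) *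
            qfac (q ^ 4) (c : ℤ)))

/-- F^{⊗6}, identified with `(Fin 6 → ℕ) →₀ Fq` via its standard basis
|m₁⟩⊗⋯⊗|m₆⟩ ↔ single (m₁,…,m₆). -/
abbrev W6 : Type := (Fin 6 → ℕ) →₀ Fq

def upd3 {n : ℕ} (f : Fin n → ℕ) (p1 p2 p3 : Fin n) (a b c : ℕ) : Fin n → ℕ :=
  Function.update (Function.update (Function.update f p1 a) p2 b) p3 c

/-- The operator 𝒮 acting on the tensor factors in positions p1, p2, p3 of F^{⊗6}
and as the identity on the other factors. -/
def S6 (p1 p2 p3 : Fin 6) : W6 →ₗ[Fq] W6 :=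
  Finsupp.lift W6 Fq (Fin 6 → ℕ) fun f =>
    ∑ᶠ a : ℕ, ∑ᶠ b : ℕ, ∑ᶠ c : ℕ,
      Scoef a b c (f p1) (f p2) (f p3) • Finsupp.single (upd3 f p1 p2 p3 a b c) 1


set_option linter.unusedVariables false
set_option linter.unusedSimpArgs false

lemma tq_ne : q ≠ 0 := RatFunc.X_ne_zero

lemma tq_pow_ne (n : ℕ) (hn : 0 < n) : (1 : Fq) - q ^ n ≠ 0 := by
  intro h
  have h1 : (RatFunc.X : RatFunc ℚ) ^ n = 1 := (sub_eq_zero.mp h).symm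
  have h2 : algebraMap (Polynomial ℚ) (RatFunc ℚ) (Polynomial.X ^ n)
      = algebraMap (Polynomial ℚ) (RatFunc ℚ) 1 := by
    simpa using h1
  have h3 := RatFunc.algebraMap_injective ℚ h2
  have h4 := congrArg Polynomial.natDegree h3
  simp at h4
  omega

/-- Gaussian binomials with base `q ^ 4`. -/
def gb : ℕ → ℕ → Fq
  | _, 0 => 1
  | 0, _ + 1 => 0
  | n + 1, m + 1 => gb n (m + 1) + q ^ (4 * ((n : ℤ) - (m : ℤ))) * gb n m

lemma gb_zero_right (n : ℕ) : gb n 0 = 1 := by cases n <;> simp [gb]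
lemma gb_zero_succ (m : ℕ) : gb 0 (m + 1) = 0 := by simp [gb]
lemma gb_succ_succ (n m : ℕ) :
    gb (n + 1) (m + 1) = gb n (m + 1) + q ^ (4 * ((n : ℤ) - (m : ℤ))) * gb n m := by
  simp [gb]

lemma gb_lt : ∀ (n m : ℕ), n < m → gb n m = 0
  | 0, 0, h => by omega
  | 0, m + 1, _ => gb_zero_succ m
  | n + 1, 0, h => by omega
  | n + 1, m + 1, h => by
      rw [gb_succ_succ, gb_lt n (m + 1) (by omega), gb_lt n m (by omega)]; simp

lemma qfac_zero (p : Fq) : qfac p 0 = 1 := by simp [qfac]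
lemma qfac_succ (p : Fq) (n : ℕ) : qfac p ((n : ℤ) + 1) = qfac p n * (1 - p ^ (n + 1)) := by
  have h : ((n : ℤ) + 1).toNat = n + 1 := by omega
  rw [qfac, qfac, if_pos (by omega), if_pos (by omega), h, Finset.prod_range_succ]
  simp
lemma qfac_neg (p : Fq) (n : ℤ) (h : n < 0) : qfac p n = 0 := by
  rw [qfac, if_neg (by omega)]
lemma qfac_ne (n : ℕ) : qfac (q ^ 4) n ≠ 0 := by
  rw [qfac, if_pos (by omega)]
  refine Finset.prod_ne_zero_iff.mpr fun l _ => ?_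
  rw [← pow_mul]
  exact tq_pow_ne _ (by omega)

lemma gb_qfac : ∀ (m d : ℕ),
    gb (m + d) m * (qfac (q ^ 4) m * qfac (q ^ 4) d) = qfac (q ^ 4) ((m : ℤ) + (d : ℤ))
  | 0, d => by simp [gb_zero_right, qfac_zero]
  | m + 1, 0 => by
      have h := gb_qfac m 0
      simp only [add_zero, Nat.cast_zero, qfac_zero, mul_one] at h ⊢
      rw [gb_succ_succ, gb_lt m (m + 1) (by omega)]
      push_cast
      rw [qfac_succ]
      simp only [sub_self, mul_zero, zpow_zero]
      linear_combination (1 - (q ^ 4) ^ (m + 1)) * h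
  | m + 1, d + 1 => by
      have h1 := gb_qfac (m + 1) d
      have h2 := gb_qfac m (d + 1)
      have e1 : m + 1 + (d + 1) = (m + d + 1) + 1 := by ring
      have e2 : m + (d + 1) = m + d + 1 := by ring
      have e3 : m + 1 + d = m + d + 1 := by ring
      rw [e1, gb_succ_succ]
      rw [e3] at h1
      rw [e2] at h2
      have hc : ((m + 1 : ℕ) : ℤ) + ((d + 1 : ℕ) : ℤ) = ((m + d + 1 : ℕ) : ℤ) + 1 := by
        push_cast; ring
      have hc1 : ((m + 1 : ℕ) : ℤ) + (d : ℤ) = ((m + d + 1 : ℕ) : ℤ) := by push_cast; ring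
      have hc2 : (m : ℤ) + ((d + 1 : ℕ) : ℤ) = ((m + d + 1 : ℕ) : ℤ) := by push_cast; ring
      rw [hc, qfac_succ]
      rw [hc1] at h1
      rw [hc2] at h2
      have hd : qfac (q ^ 4) ((d + 1 : ℕ) : ℤ) = qfac (q ^ 4) d * (1 - (q ^ 4) ^ (d + 1)) := by
        push_cast; exact qfac_succ _ _
      have hm : qfac (q ^ 4) ((m + 1 : ℕ) : ℤ) = qfac (q ^ 4) m * (1 - (q ^ 4) ^ (m + 1)) := by
        push_cast; exact qfac_succ _ _
      have hz : q ^ (4 * (((m + d + 1 : ℕ) : ℤ) - (m : ℤ))) = (q ^ 4) ^ (d + 1) := by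
        rw [← pow_mul, ← zpow_natCast]
        congr 1
        push_cast; ring
      rw [hz]
      rw [hm] at h1 ⊢
      rw [hd] at h2 ⊢
      have hp : (q ^ 4) ^ (m + d + 1 + 1) = (q ^ 4) ^ (m + 1) * (q ^ 4) ^ (d + 1) := by
        rw [← pow_add]; congr 1; ring
      rw [hp]
      linear_combination (1 - (q ^ 4) ^ (d + 1)) * h1
        + (q ^ 4) ^ (d + 1) * (1 - (q ^ 4) ^ (m + 1)) * h2

/-- Falling `q`-product. -/
def ff (n : ℤ) (m : ℕ) : Fq := ∏ t ∈ Finset.range m, (1 - q ^ (4 * (n - (t : ℤ))))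

lemma ff_succ (n : ℤ) (m : ℕ) : ff n (m + 1) = ff n m * (1 - q ^ (4 * (n - (m : ℤ)))) := by
  rw [ff, Finset.prod_range_succ, ← ff]

lemma ff_zero (n : ℤ) : ff n 0 = 1 := by simp [ff]

lemma ff_vanish (n m : ℕ) (h : n < m) : ff n m = 0 := by
  rw [ff]
  refine Finset.prod_eq_zero (i := n) (by simpa using h) (by simp)

lemma ff_qfac (c : ℕ) : ∀ m : ℕ,
    ff ((c : ℤ) + (m : ℤ)) m * qfac (q ^ 4) c = qfac (q ^ 4) ((c : ℤ) + (m : ℤ)) := by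
  intro m
  induction m generalizing c with
  | zero => simp [ff_zero]
  | succ m ih =>
      have h := ih (c + 1)
      have e : ((c + 1 : ℕ) : ℤ) + (m : ℤ) = (c : ℤ) + ((m + 1 : ℕ) : ℤ) := by push_cast; ring
      rw [e] at h
      rw [ff_succ]
      have e2 : q ^ (4 * ((c : ℤ) + ((m + 1 : ℕ) : ℤ) - (m : ℤ))) = (q ^ 4) ^ (c + 1) := by
        rw [← pow_mul, ← zpow_natCast]; congr 1; push_cast; ring
      have hc : qfac (q ^ 4) ((c + 1 : ℕ) : ℤ) = qfac (q ^ 4) c * (1 - (q ^ 4) ^ (c + 1)) := by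
        push_cast; exact qfac_succ _ _
      rw [hc] at h
      rw [e2, ← h]; ring

/-- One term of the matrix element, as a function of `l = λ` and `m = μ`. -/
def Dt (l m i j k : ℕ) : Fq :=
  (-1 : Fq) ^ l * q ^ (2 * ((i : ℤ) * ((k : ℤ) - ((l : ℤ) + (m : ℤ))) + ((k : ℤ) + 1) * (l : ℤ)
    + (m : ℤ) * ((m : ℤ) - (k : ℤ)))) * gb i m * gb j l * ff ((j : ℤ) + (k : ℤ) - (l : ℤ)) m

/-- The matrix element, extended by zero. -/
def Dc (b i j k : ℕ) : Fq := ∑ m ∈ Finset.range (b + 1), Dt (b - m) m i j k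

lemma Scoef_eq (a b c i j k : ℕ) (h1 : i + j = a + b) (h2 : j + k = b + c) :
    Scoef a b c i j k = Dc b i j k := by
  rw [Scoef, if_pos h1, if_pos h2, Dc, one_mul, one_mul]
  refine Finset.sum_congr rfl fun m hm => ?_
  have hmb : m ≤ b := by simpa [Nat.lt_succ_iff] using hm
  obtain ⟨l, rfl⟩ := Nat.exists_eq_add_of_le hmb
  have el : m + l - m = l := by omega
  have el2 : ((m + l : ℕ) : ℤ) - (m : ℤ) = l := by push_cast; ring
  rw [el, el2, Dt]
  by_cases hi : m ≤ i
  · by_cases hj : l ≤ j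
    · obtain ⟨d, rfl⟩ := Nat.exists_eq_add_of_le hi
      obtain ⟨g, rfl⟩ := Nat.exists_eq_add_of_le hj
      have hg1 := gb_qfac m d
      have hg2 := gb_qfac l g
      have hf := ff_qfac c m
      have e1 : ((m + d : ℕ) : ℤ) - (m : ℤ) = d := by push_cast; ring
      have e2 : ((l + g : ℕ) : ℤ) - (l : ℤ) = g := by push_cast; ring
      have e3 : ((l + g : ℕ) : ℤ) + (k : ℤ) - (l : ℤ) = (c : ℤ) + (m : ℤ) := by
        have : ((l + g + k : ℕ) : ℤ) = ((m + l + c : ℕ) : ℤ) := by rw [h2]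
        push_cast at this ⊢; linarith
      have e4 : (2 * ((m + d : ℕ) : ℤ) * ((c : ℤ) - ((l + g : ℕ) : ℤ)) + 2 * ((k : ℤ) + 1) * (l : ℤ)
          + 2 * (m : ℤ) * ((m : ℤ) - (k : ℤ))) = 2 * (((m + d : ℕ) : ℤ) * ((k : ℤ)
          - ((l : ℤ) + (m : ℤ))) + ((k : ℤ) + 1) * (l : ℤ) + (m : ℤ) * ((m : ℤ) - (k : ℤ))) := by
        have : (c : ℤ) = (l : ℤ) + g + k - m - l := by
          have : ((l + g + k : ℕ) : ℤ) = ((m + l + c : ℕ) : ℤ) := by rw [h2]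
          push_cast at this ⊢; linarith
        rw [this]; push_cast; ring
      rw [e1, e2, e3, e4]
      have n1 := qfac_ne m
      have n2 := qfac_ne d
      have n3 := qfac_ne l
      have n4 := qfac_ne g
      have n5 := qfac_ne c
      push_cast
      rw [← hg1, ← hg2, ← hf]
      field_simp
    · rw [gb_lt j l (by omega), qfac_neg _ ((j : ℤ) - (l : ℤ)) (by omega)]; simp
  · rw [gb_lt i m (by omega), qfac_neg _ ((i : ℤ) - (m : ℤ)) (by omega)]; simp

lemma Dc_zero1 (b i j k : ℕ) (h : i + j < b) : Dc b i j k = 0 := by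
  refine Finset.sum_eq_zero fun m hm => ?_
  have hmb : m ≤ b := by simpa [Nat.lt_succ_iff] using hm
  rw [Dt]
  by_cases hi : m ≤ i
  · rw [gb_lt j (b - m) (by omega)]; simp
  · rw [gb_lt i m (by omega)]; simp

lemma Dc_zero2 (b i j k : ℕ) (h : j + k < b) : Dc b i j k = 0 := by
  refine Finset.sum_eq_zero fun m hm => ?_
  have hmb : m ≤ b := by simpa [Nat.lt_succ_iff] using hm
  rw [Dt]
  by_cases hj : b - m ≤ j
  · have e : (j : ℤ) + (k : ℤ) - ((b - m : ℕ) : ℤ) = ((j + k - (b - m) : ℕ) : ℤ) := by omega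
    rw [e, ff_vanish _ _ (by omega)]; simp
  · rw [gb_lt j (b - m) (by omega)]; simp

lemma Dt_rec (l m i j k : ℕ) :
    q ^ (2 * (j : ℤ)) * Dt l (m + 1) (i + 1) j k
      = q ^ (2 * ((j : ℤ) + k - (l + m + 1))) * Dt l (m + 1) i j k
        + q ^ (2 * ((i : ℤ) + j - (l + m))) * (1 - q ^ (4 * ((j : ℤ) + k - (l + m))))
          * Dt l m i j k := by
  have hq := tq_ne
  simp only [Dt, gb_succ_succ, ff_succ]
  have e : (j : ℤ) + k - l - m = (j : ℤ) + k - (l + m) := by ring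
  rw [e]
  generalize ff ((j : ℤ) + k - l) m = A
  generalize gb j l = B
  generalize gb i (m + 1) = C
  generalize gb i m = G
  generalize (1 - q ^ (4 * ((j : ℤ) + k - (l + m)))) = H
  generalize (-1 : Fq) ^ l = J
  push_cast
  have z1 : q ^ (2 * (j : ℤ)) * q ^ (2 * (((i : ℤ) + 1) * (k - (l + (m + 1))) + (k + 1) * l
      + (m + 1) * (m + 1 - k))) = q ^ (2 * ((j : ℤ) + k - (l + m + 1))) * q ^ (2 * ((i : ℤ) *
      (k - (l + (m + 1))) + (k + 1) * l + (m + 1) * (m + 1 - k))) := by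
    rw [← zpow_add₀ hq, ← zpow_add₀ hq]; congr 1; ring
  have z2 : q ^ (2 * (j : ℤ)) * q ^ (2 * (((i : ℤ) + 1) * (k - (l + (m + 1))) + (k + 1) * l
      + (m + 1) * (m + 1 - k))) * q ^ (4 * ((i : ℤ) - m)) = q ^ (2 * ((i : ℤ) + j - (l + m)))
      * q ^ (2 * ((i : ℤ) * (k - (l + m)) + (k + 1) * l + m * (m - k))) := by
    rw [← zpow_add₀ hq, ← zpow_add₀ hq, ← zpow_add₀ hq]; congr 1; ring
  linear_combination J * C * B * A * H * z1 + J * G * B * A * H * z2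

lemma Dt_rec0 (l i j k : ℕ) :
    q ^ (2 * (j : ℤ)) * Dt l 0 (i + 1) j k
      = q ^ (2 * ((j : ℤ) + k - l)) * Dt l 0 i j k := by
  have hq := tq_ne
  simp only [Dt, gb_zero_right, ff_zero]
  push_cast
  have z1 : q ^ (2 * (j : ℤ)) * q ^ (2 * (((i : ℤ) + 1) * (k - (l + 0)) + (k + 1) * l
      + 0 * (0 - k))) = q ^ (2 * ((j : ℤ) + k - l)) * q ^ (2 * ((i : ℤ) *
      (k - (l + 0)) + (k + 1) * l + 0 * (0 - k))) := by
    rw [← zpow_add₀ hq, ← zpow_add₀ hq]; congr 1; ring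
  linear_combination (-1 : Fq) ^ l * gb j l * z1

lemma Dc_rec0 (i j k : ℕ) :
    q ^ (2 * (j : ℤ)) * Dc 0 (i + 1) j k = q ^ (2 * ((j : ℤ) + k)) * Dc 0 i j k := by
  simpa [Dc] using Dt_rec0 0 i j k

lemma Dc_rec (b i j k : ℕ) :
    q ^ (2 * (j : ℤ)) * Dc (b + 1) (i + 1) j k
      = q ^ (2 * ((j : ℤ) + k - (b + 1))) * Dc (b + 1) i j k
        + q ^ (2 * ((i : ℤ) + j - b)) * (1 - q ^ (4 * ((j : ℤ) + k - b))) * Dc b i j k := by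
  rw [Dc, Dc, Dc, Finset.sum_range_succ', Finset.sum_range_succ' _ (b + 1), mul_add, mul_add]
  rw [Nat.sub_zero, Dt_rec0]
  simp only [Nat.add_sub_add_right, Finset.mul_sum]
  push_cast
  rw [add_right_comm, ← Finset.sum_add_distrib]
  congr 1
  refine Finset.sum_congr rfl fun m hm => ?_
  have hmb : m ≤ b := by simpa [Nat.lt_succ_iff] using hm
  obtain ⟨l, rfl⟩ := Nat.exists_eq_add_of_le hmb
  have el : m + l - m = l := by omega
  have := Dt_rec l m i j k
  rw [el, this]
  push_cast
  rw [add_comm (m : ℤ) l]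

lemma Dc_i0 (b j k : ℕ) :
    Dc b 0 j k = (-1 : Fq) ^ b * q ^ (2 * ((k : ℤ) + 1) * b) * gb j b := by
  rw [Dc, Finset.sum_range_succ', Finset.sum_eq_zero]
  · simp [Dt, gb_zero_right, ff_zero, mul_assoc]
  · intro m _
    simp [Dt, gb_zero_succ]

lemma Dc_j_rec0 (j k : ℕ) : Dc 0 0 (j + 1) k = Dc 0 0 j k := by
  simp [Dc_i0, gb_zero_right]

lemma Dc_j_rec (b j k : ℕ) :
    Dc (b + 1) 0 (j + 1) k = Dc (b + 1) 0 j k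
      - q ^ (2 * (1 + ((j : ℤ) - b) + ((j : ℤ) + k - b))) * Dc b 0 j k := by
  have hq := tq_ne
  simp only [Dc_i0, gb_succ_succ]
  push_cast
  have z : q ^ (2 * ((k : ℤ) + 1) * (b + 1)) * q ^ (4 * ((j : ℤ) - b))
      = q ^ (2 * (1 + ((j : ℤ) - b) + ((j : ℤ) + k - b))) * q ^ (2 * ((k : ℤ) + 1) * b) := by
    rw [← zpow_add₀ hq, ← zpow_add₀ hq]; congr 1; ring
  rw [pow_succ]
  linear_combination -(-1 : Fq) ^ b * gb j b * z


/-- Basis vector of `F^{⊗6}`. -/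
def bv (f : Fin 6 → ℕ) : W6 := Finsupp.single f 1

lemma lift_bv (g : (Fin 6 → ℕ) → W6) (f : Fin 6 → ℕ) :
    Finsupp.lift W6 Fq (Fin 6 → ℕ) g (bv f) = g f := by
  simp [bv, Finsupp.lift_apply]

lemma end_ext {A B : Module.End Fq W6} (h : ∀ f, A (bv f) = B (bv f)) : A = B := by
  refine Finsupp.lhom_ext' fun f => LinearMap.ext_ring ?_
  simpa [bv] using h f

/-- creation operator at position `p` -/
def oP (p : Fin 6) : Module.End Fq W6 :=
  Finsupp.lift W6 Fq (Fin 6 → ℕ) fun f => bv (Function.update f p (f p + 1))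
/-- annihilation operator at position `p` -/
def oM (p : Fin 6) : Module.End Fq W6 :=
  Finsupp.lift W6 Fq (Fin 6 → ℕ) fun f =>
    (1 - q ^ (4 * (f p : ℤ))) • bv (Function.update f p (f p - 1))
/-- number operator at position `p` -/
def oK (p : Fin 6) : Module.End Fq W6 :=
  Finsupp.lift W6 Fq (Fin 6 → ℕ) fun f => q ^ (2 * (f p : ℤ)) • bv f

lemma oP_bv (p : Fin 6) (f) : oP p (bv f) = bv (Function.update f p (f p + 1)) := lift_bv _ _
lemma oM_bv (p : Fin 6) (f) :
    oM p (bv f) = (1 - q ^ (4 * (f p : ℤ))) • bv (Function.update f p (f p - 1)) := lift_bv _ _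
lemma oK_bv (p : Fin 6) (f) : oK p (bv f) = q ^ (2 * (f p : ℤ)) • bv f := lift_bv _ _

lemma oM_bv0 (p : Fin 6) (f) (h : f p = 0) : oM p (bv f) = 0 := by
  rw [oM_bv, h]; simp
lemma oK_bv0 (p : Fin 6) (f) (h : f p = 0) : oK p (bv f) = bv f := by
  rw [oK_bv, h]; simp

/-! same-site relations -/

lemma rPK (p : Fin 6) : oP p * oK p = (q ^ 2)⁻¹ • (oK p * oP p) := by
  refine end_ext fun f => ?_
  have hq := tq_ne
  simp only [Module.End.mul_apply, LinearMap.smul_apply, oK_bv, oP_bv, map_smul, smul_smul,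
    Function.update_self]
  congr 1
  push_cast
  rw [mul_add, zpow_add₀ hq]
  field_simp
  norm_cast

lemma rMK (p : Fin 6) : oM p * oK p = q ^ 2 • (oK p * oM p) := by
  refine end_ext fun f => ?_
  have hq := tq_ne
  simp only [Module.End.mul_apply, LinearMap.smul_apply, oK_bv, oM_bv, map_smul, smul_smul,
    Function.update_self]
  rcases Nat.eq_zero_or_pos (f p) with h | h
  · simp [h]
  · congr 1
    have : ((f p - 1 : ℕ) : ℤ) = (f p : ℤ) - 1 := by omega
    have z : q ^ (2 * (f p : ℤ)) = q ^ 2 * q ^ (2 * ((f p : ℤ) - 1)) := by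
      have : q ^ 2 = q ^ (2 : ℤ) := by norm_cast
      rw [this, ← zpow_add₀ hq]; congr 1; ring
    rw [this, z]
    ring

lemma rPM (p : Fin 6) : oP p * oM p = 1 - oK p * oK p := by
  refine end_ext fun f => ?_
  have hq := tq_ne
  simp only [Module.End.mul_apply, LinearMap.sub_apply, Module.End.one_apply, oK_bv, oM_bv, oP_bv,
    map_smul, smul_smul, Function.update_self, Function.update_idem]
  rw [← zpow_add₀ hq]
  rcases Nat.eq_zero_or_pos (f p) with h | h
  · simp [h]
  · rw [Nat.sub_add_cancel h, Function.update_eq_self, sub_smul, one_smul]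
    congr 3; ring

lemma rMP (p : Fin 6) : oM p * oP p = 1 - q ^ 4 • (oK p * oK p) := by
  refine end_ext fun f => ?_
  have hq := tq_ne
  simp only [Module.End.mul_apply, LinearMap.sub_apply, Module.End.one_apply, oK_bv, oM_bv, oP_bv,
    map_smul, smul_smul, Function.update_self, Function.update_idem, LinearMap.smul_apply]
  rw [← zpow_add₀ hq, Nat.add_sub_cancel, Function.update_eq_self, sub_smul, one_smul]
  congr 2
  have : (4 : ℤ) * ((f p + 1 : ℕ) : ℤ) = 4 + (2 * (f p : ℤ) + 2 * (f p : ℤ)) := by push_cast; ring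
  rw [this, zpow_add₀ hq]
  norm_cast

/-! different-site relations -/

section
variable {p r : Fin 6}

lemma cPP (h : p ≠ r) : oP r * oP p = oP p * oP r := by
  refine end_ext fun f => ?_
  simp only [Module.End.mul_apply, oP_bv, Function.update_of_ne h, Function.update_of_ne h.symm]
  rw [Function.update_comm h]
lemma cPM (h : p ≠ r) : oP r * oM p = oM p * oP r := by
  refine end_ext fun f => ?_
  simp only [Module.End.mul_apply, oP_bv, oM_bv, map_smul, Function.update_of_ne h,
    Function.update_of_ne h.symm]
  rw [Function.update_comm h]
lemma cMM (h : p ≠ r) : oM r * oM p = oM p * oM r := by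
  refine end_ext fun f => ?_
  simp only [Module.End.mul_apply, oM_bv, map_smul, Function.update_of_ne h,
    Function.update_of_ne h.symm]
  rw [Function.update_comm h, smul_comm]
lemma cKP (h : p ≠ r) : oK r * oP p = oP p * oK r := by
  refine end_ext fun f => ?_
  simp only [Module.End.mul_apply, oP_bv, oK_bv, map_smul, Function.update_of_ne h.symm]
lemma cKM (h : p ≠ r) : oK r * oM p = oM p * oK r := by
  refine end_ext fun f => ?_
  simp only [Module.End.mul_apply, oM_bv, oK_bv, map_smul, Function.update_of_ne h.symm]
  rw [smul_comm]
lemma cKK (p r : Fin 6) : oK r * oK p = oK p * oK r := by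
  refine end_ext fun f => ?_
  simp only [Module.End.mul_apply, oK_bv, map_smul]
  rw [smul_comm]
end

/-! the operator `S6` on basis vectors -/

lemma S6_bv (p1 p2 p3 : Fin 6) (f : Fin 6 → ℕ) (N : ℕ) (hN : f p2 + f p3 < N) :
    S6 p1 p2 p3 (bv f) = ∑ b ∈ Finset.range N, Dc b (f p1) (f p2) (f p3) •
      bv (upd3 f p1 p2 p3 (f p1 + f p2 - b) b (f p2 + f p3 - b)) := by
  rw [S6, lift_bv]
  have hz : ∀ a b c, ¬ (f p1 + f p2 = a + b ∧ f p2 + f p3 = b + c) →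
      Scoef a b c (f p1) (f p2) (f p3) = 0 := by
    intro a b c h
    rw [Scoef]
    by_cases h1 : f p1 + f p2 = a + b
    · have : ¬ (f p2 + f p3 = b + c) := fun h2 => h ⟨h1, h2⟩
      rw [if_neg this]; simp
    · rw [if_neg h1]; simp
  set G : ℕ → ℕ → ℕ → W6 := fun a b c => Scoef a b c (f p1) (f p2) (f p3) •
    Finsupp.single (upd3 f p1 p2 p3 a b c) 1 with hG
  have hc : ∀ a b, (∑ᶠ c, G a b c) = G a b (f p2 + f p3 - b) := by
    intro a b
    refine finsum_eq_single _ _ fun c hc => ?_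
    simp only [hG]
    rw [hz a b c (by omega), zero_smul]
  have hb : ∀ a, (∑ᶠ b, ∑ᶠ c, G a b c)
      = if a ≤ f p1 + f p2 then G a (f p1 + f p2 - a) (f p2 + f p3 - (f p1 + f p2 - a)) else 0 := by
    intro a
    simp only [hc]
    split_ifs with ha
    · refine finsum_eq_single _ _ fun b hb => ?_
      simp only [hG]
      rw [hz _ _ _ (by omega), zero_smul]
    · rw [← finsum_zero (α := ℕ)]
      refine finsum_congr fun b => ?_
      simp only [hG]
      rw [hz _ _ _ (by omega), zero_smul]
  show (∑ᶠ a, ∑ᶠ b, ∑ᶠ c, G a b c) = _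
  simp only [hb]
  rw [finsum_eq_sum_of_support_subset (s := Finset.range (f p1 + f p2 + 1))]
  swap
  · intro a ha
    by_contra h
    apply ha
    have : ¬ a ≤ f p1 + f p2 := by simpa [Nat.lt_succ_iff] using h
    simp [this]
  rw [← Finset.sum_range_reflect]
  have key : ∀ b, b ≤ f p1 + f p2 → (if f p1 + f p2 + 1 - 1 - b ≤ f p1 + f p2 then
      G (f p1 + f p2 + 1 - 1 - b) (f p1 + f p2 - (f p1 + f p2 + 1 - 1 - b))
        (f p2 + f p3 - (f p1 + f p2 - (f p1 + f p2 + 1 - 1 - b))) else 0)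
      = Dc b (f p1) (f p2) (f p3) •
        bv (upd3 f p1 p2 p3 (f p1 + f p2 - b) b (f p2 + f p3 - b)) := by
    intro b hb'
    have e1 : f p1 + f p2 + 1 - 1 - b = f p1 + f p2 - b := by omega
    have e2 : f p1 + f p2 - (f p1 + f p2 - b) = b := by omega
    rw [e1, if_pos (by omega), e2]
    simp only [hG, bv]
    by_cases h2 : b ≤ f p2 + f p3
    · rw [Scoef_eq _ _ _ _ _ _ (by omega) (by omega)]
    · rw [hz _ _ _ (by omega), Dc_zero2 _ _ _ _ (by omega)]
  rw [Finset.sum_congr rfl fun b hb' => key b (by simpa [Nat.lt_succ_iff] using hb')]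
  have hmax : ∀ n, (∀ b, n ≤ b → Dc b (f p1) (f p2) (f p3) = 0) →
      n ≤ max (f p1 + f p2 + 1) N →
      ∑ b ∈ Finset.range n, Dc b (f p1) (f p2) (f p3) •
        bv (upd3 f p1 p2 p3 (f p1 + f p2 - b) b (f p2 + f p3 - b))
      = ∑ b ∈ Finset.range (max (f p1 + f p2 + 1) N), Dc b (f p1) (f p2) (f p3) •
        bv (upd3 f p1 p2 p3 (f p1 + f p2 - b) b (f p2 + f p3 - b)) := by
    intro n hn hle
    refine Finset.sum_subset (by simpa using hle) fun b _ hb' => ?_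
    rw [hn b (by simpa using hb'), zero_smul]
  rw [hmax _ (fun b h => Dc_zero1 _ _ _ _ (by omega)) (le_max_left _ _),
    hmax N (fun b h => Dc_zero2 _ _ _ _ (by omega)) (le_max_right _ _)]

section
variable {p1 p2 p3 : Fin 6}

lemma upd3_1 (h12 : p1 ≠ p2) (h13 : p1 ≠ p3) (f : Fin 6 → ℕ) (a b c : ℕ) :
    upd3 f p1 p2 p3 a b c p1 = a := by
  simp [upd3, Function.update_of_ne h12, Function.update_of_ne h13]
lemma upd3_2 (h23 : p2 ≠ p3) (f : Fin 6 → ℕ) (a b c : ℕ) :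
    upd3 f p1 p2 p3 a b c p2 = b := by
  simp [upd3, Function.update_of_ne h23]
lemma upd3_3 (f : Fin 6 → ℕ) (a b c : ℕ) :
    upd3 f p1 p2 p3 a b c p3 = c := by
  simp [upd3]
lemma upd3_ne (f : Fin 6 → ℕ) (a b c : ℕ) (s : Fin 6) (h1 : s ≠ p1) (h2 : s ≠ p2) (h3 : s ≠ p3) :
    upd3 f p1 p2 p3 a b c s = f s := by
  simp [upd3, Function.update_of_ne h1, Function.update_of_ne h2, Function.update_of_ne h3]
lemma upd3_upd1 (h12 : p1 ≠ p2) (h13 : p1 ≠ p3) (f : Fin 6 → ℕ) (a b c a' : ℕ) :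
    Function.update (upd3 f p1 p2 p3 a b c) p1 a' = upd3 f p1 p2 p3 a' b c := by
  simp only [upd3]
  rw [Function.update_comm h13.symm, Function.update_comm h12.symm, Function.update_idem]
lemma upd3_upd2 (h23 : p2 ≠ p3) (f : Fin 6 → ℕ) (a b c b' : ℕ) :
    Function.update (upd3 f p1 p2 p3 a b c) p2 b' = upd3 f p1 p2 p3 a b' c := by
  simp only [upd3]
  rw [Function.update_comm h23.symm, Function.update_idem]
lemma upd3_upd3 (f : Fin 6 → ℕ) (a b c c' : ℕ) :
    Function.update (upd3 f p1 p2 p3 a b c) p3 c' = upd3 f p1 p2 p3 a b c' := by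
  simp only [upd3, Function.update_idem]
lemma upd3_of_upd1 (h12 : p1 ≠ p2) (h13 : p1 ≠ p3) (f : Fin 6 → ℕ) (a b c a' : ℕ) :
    upd3 (Function.update f p1 a') p1 p2 p3 a b c = upd3 f p1 p2 p3 a b c := by
  simp only [upd3, Function.update_idem]
lemma upd3_of_upd2 (h12 : p1 ≠ p2) (f : Fin 6 → ℕ) (a b c a' : ℕ) :
    upd3 (Function.update f p2 a') p1 p2 p3 a b c = upd3 f p1 p2 p3 a b c := by
  simp only [upd3]
  rw [Function.update_comm h12.symm, Function.update_idem]
lemma upd3_of_ne (f : Fin 6 → ℕ) (a b c : ℕ) (s : Fin 6) (x : ℕ)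
    (h1 : s ≠ p1) (h2 : s ≠ p2) (h3 : s ≠ p3) :
    upd3 (Function.update f s x) p1 p2 p3 a b c
      = Function.update (upd3 f p1 p2 p3 a b c) s x := by
  simp only [upd3]
  rw [Function.update_comm h1, Function.update_comm h2, Function.update_comm h3]
lemma upd3_self (f : Fin 6 → ℕ) :
    upd3 f p1 p2 p3 (f p1) (f p2) (f p3) = f := by
  simp [upd3, Function.update_eq_self]

lemma S6_comm_P (s : Fin 6) (h1 : s ≠ p1) (h2 : s ≠ p2) (h3 : s ≠ p3) :
    S6 p1 p2 p3 * oP s = oP s * S6 p1 p2 p3 := by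
  refine end_ext fun f => ?_
  simp only [Module.End.mul_apply]
  rw [S6_bv p1 p2 p3 f _ (Nat.lt_succ_self _), map_sum, oP_bv,
    S6_bv p1 p2 p3 _ (f p2 + f p3 + 1)
      (by rw [Function.update_of_ne h2.symm, Function.update_of_ne h3.symm]; omega)]
  refine Finset.sum_congr rfl fun b _ => ?_
  rw [map_smul, oP_bv, Function.update_of_ne h1.symm, Function.update_of_ne h2.symm,
    Function.update_of_ne h3.symm, upd3_of_ne _ _ _ _ _ _ h1 h2 h3, upd3_ne _ _ _ _ _ h1 h2 h3]

lemma S6_comm_M (s : Fin 6) (h1 : s ≠ p1) (h2 : s ≠ p2) (h3 : s ≠ p3) :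
    S6 p1 p2 p3 * oM s = oM s * S6 p1 p2 p3 := by
  refine end_ext fun f => ?_
  simp only [Module.End.mul_apply]
  rw [S6_bv p1 p2 p3 f _ (Nat.lt_succ_self _), map_sum, oM_bv, map_smul,
    S6_bv p1 p2 p3 _ (f p2 + f p3 + 1)
      (by rw [Function.update_of_ne h2.symm, Function.update_of_ne h3.symm]; omega),
    Finset.smul_sum]
  refine Finset.sum_congr rfl fun b _ => ?_
  rw [map_smul, oM_bv, Function.update_of_ne h1.symm, Function.update_of_ne h2.symm,
    Function.update_of_ne h3.symm, upd3_of_ne _ _ _ _ _ _ h1 h2 h3, upd3_ne _ _ _ _ _ h1 h2 h3,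
    smul_comm]

lemma S6_comm_K (s : Fin 6) (h1 : s ≠ p1) (h2 : s ≠ p2) (h3 : s ≠ p3) :
    S6 p1 p2 p3 * oK s = oK s * S6 p1 p2 p3 := by
  refine end_ext fun f => ?_
  simp only [Module.End.mul_apply]
  rw [oK_bv, map_smul, S6_bv p1 p2 p3 f _ (Nat.lt_succ_self _), map_sum,
    Finset.smul_sum]
  refine Finset.sum_congr rfl fun b _ => ?_
  rw [map_smul, oK_bv, upd3_ne _ _ _ _ _ h1 h2 h3, smul_comm]

/-- conservation laws -/
lemma S6_KK12 (h12 : p1 ≠ p2) (h13 : p1 ≠ p3) (h23 : p2 ≠ p3) :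
    S6 p1 p2 p3 * (oK p1 * oK p2) = (oK p1 * oK p2) * S6 p1 p2 p3 := by
  refine end_ext fun f => ?_
  have hq := tq_ne
  simp only [Module.End.mul_apply]
  rw [oK_bv, map_smul, oK_bv, map_smul, map_smul, S6_bv p1 p2 p3 f _ (Nat.lt_succ_self _), map_sum,
    map_sum, Finset.smul_sum, Finset.smul_sum]
  refine Finset.sum_congr rfl fun b _ => ?_
  rw [map_smul, oK_bv, map_smul, map_smul, oK_bv, upd3_1 h12 h13, upd3_2 h23]
  simp only [smul_smul]
  by_cases hb : b ≤ f p1 + f p2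
  · congr 1
    have : q ^ (2 * (f p2 : ℤ)) * q ^ (2 * (f p1 : ℤ))
        = q ^ (2 * (b : ℤ)) * q ^ (2 * ((f p1 + f p2 - b : ℕ) : ℤ)) := by
      rw [← zpow_add₀ hq, ← zpow_add₀ hq]; congr 1; omega
    linear_combination Dc b (f p1) (f p2) (f p3) * this
  · rw [Dc_zero1 _ _ _ _ (by omega)]; simp

lemma S6_KK23 (h23 : p2 ≠ p3) :
    S6 p1 p2 p3 * (oK p2 * oK p3) = (oK p2 * oK p3) * S6 p1 p2 p3 := by
  refine end_ext fun f => ?_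
  have hq := tq_ne
  simp only [Module.End.mul_apply]
  rw [oK_bv, map_smul, oK_bv, map_smul, map_smul, S6_bv p1 p2 p3 f _ (Nat.lt_succ_self _), map_sum,
    map_sum, Finset.smul_sum, Finset.smul_sum]
  refine Finset.sum_congr rfl fun b _ => ?_
  rw [map_smul, oK_bv, map_smul, map_smul, oK_bv, upd3_3, upd3_2 h23]
  simp only [smul_smul]
  by_cases hb : b ≤ f p2 + f p3
  · congr 1
    have : q ^ (2 * (f p3 : ℤ)) * q ^ (2 * (f p2 : ℤ))
        = q ^ (2 * (b : ℤ)) * q ^ (2 * ((f p2 + f p3 - b : ℕ) : ℤ)) := by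
      rw [← zpow_add₀ hq, ← zpow_add₀ hq]; congr 1; omega
    linear_combination Dc b (f p1) (f p2) (f p3) * this
  · rw [Dc_zero2 _ _ _ _ (by omega)]; simp

lemma S6_vac (h12 : p1 ≠ p2) (f : Fin 6 → ℕ) (h1 : f p1 = 0) (h2 : f p2 = 0) :
    S6 p1 p2 p3 (bv f) = bv f := by
  rw [S6_bv p1 p2 p3 f _ (Nat.lt_succ_self _), Finset.sum_range_succ', Finset.sum_eq_zero]
  · rw [h1, h2, Dc_i0]
    simp only [gb_zero_right, Nat.sub_zero, zero_add]
    have := upd3_self (p1 := p1) (p2 := p2) (p3 := p3) f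
    rw [h1, h2] at this
    rw [this]; simp
  · intro b _
    rw [h1, h2, Dc_i0, gb_zero_succ]; simp

/-- creation relation for site 1 -/
lemma S6_X23 (h12 : p1 ≠ p2) (h13 : p1 ≠ p3) (h23 : p2 ≠ p3) :
    S6 p1 p2 p3 * (oP p1 * oK p2)
      = (oK p3 * oP p1 + oK p1 * oP p2 * oM p3) * S6 p1 p2 p3 := by
  refine end_ext fun f => ?_
  have hq := tq_ne
  simp only [Module.End.mul_apply, LinearMap.add_apply]
  rw [oK_bv, map_smul, map_smul, oP_bv,
    S6_bv p1 p2 p3 _ (f p2 + f p3 + 1 + 1)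
      (by rw [Function.update_of_ne h12.symm, Function.update_of_ne h13.symm]; omega),
    S6_bv p1 p2 p3 f (f p2 + f p3 + 1) (Nat.lt_succ_self _)]
  simp only [Function.update_self, Function.update_of_ne h12.symm, Function.update_of_ne h13.symm,
    upd3_of_upd1 h12 h13]
  simp only [map_sum, map_smul, oP_bv, oK_bv, oM_bv, upd3_1 h12 h13, upd3_2 h23, upd3_3,
    upd3_upd1 h12 h13, upd3_upd2 h23, upd3_upd3, Finset.smul_sum, smul_smul]
  generalize f p1 = i
  generalize f p2 = j
  generalize f p3 = k
  have ext1 : ∀ g : ℕ → W6, ∑ b ∈ Finset.range (j + k + 1), (Dc b i j k) • g b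
      = ∑ b ∈ Finset.range (j + k + 1 + 1), Dc b i j k • g b := by
    intro g
    rw [Finset.sum_range_succ _ (j + k + 1), Dc_zero2 (j + k + 1) _ _ _ (by omega)]; simp
  simp only [mul_smul]
  rw [ext1, Finset.sum_range_succ' _ (j + k + 1), Finset.sum_range_succ' _ (j + k + 1),
    add_right_comm (∑ b ∈ Finset.range (j + k + 1), _),
    ← Finset.sum_add_distrib]
  congr 1
  · refine Finset.sum_congr rfl fun b _ => ?_
    have hr := Dc_rec b i j k
    by_cases hb1 : b ≤ i + j
    · by_cases hb2 : b + 1 ≤ j + k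
      · have e1 : i + 1 + j - (b + 1) = i + j - b := by omega
        have e3 : j + k - b - 1 = j + k - (b + 1) := by omega
        rw [e1, e3]
        have e4 : ((j + k - b : ℕ) : ℤ) = (j : ℤ) + k - b := by omega
        have e5 : ((j + k - (b + 1) : ℕ) : ℤ) = (j : ℤ) + k - (b + 1) := by omega
        have e6 : ((i + j - b : ℕ) : ℤ) = (i : ℤ) + j - b := by omega
        rw [e4, e5, e6]
        by_cases hb3 : b + 1 ≤ i + j
        · have e2 : i + j - (b + 1) + 1 = i + j - b := by omega
          rw [e2]
          simp only [smul_smul, ← add_smul]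
          congr 1
          rw [hr]; ring
        · rw [Dc_zero1 (b + 1) i j k (by omega)] at hr ⊢
          rw [zero_smul, zero_add]
          simp only [smul_smul]
          congr 1
          rw [hr]; ring
      · rw [Dc_zero2 (b + 1) _ _ _ (by omega), Dc_zero2 (b + 1) _ _ _ (by omega)]
        have : b = j + k ∨ j + k < b := by omega
        rcases this with rfl | h
        · simp
        · rw [Dc_zero2 b _ _ _ (by omega)]; simp
    · rw [Dc_zero1 (b + 1) _ _ _ (by omega), Dc_zero1 (b + 1) _ _ _ (by omega),
        Dc_zero1 b _ _ _ (by omega)]; simp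
  · have e1 : i + 1 + j - 0 = i + j - 0 + 1 := by omega
    rw [e1, smul_smul, smul_smul]
    congr 1
    rw [Dc_rec0]
    push_cast
    rw [Nat.sub_zero]
    push_cast
    ring

/-- creation relation for site 2, when site 1 is empty -/
lemma S6_X33_base (h12 : p1 ≠ p2) (h13 : p1 ≠ p3) (h23 : p2 ≠ p3) (f : Fin 6 → ℕ)
    (h1 : f p1 = 0) :
    (S6 p1 p2 p3 * oP p2) (bv f)
      = ((oP p1 * oP p3 - q ^ 2 • (oK p1 * oK p3 * oP p2)) * S6 p1 p2 p3) (bv f) := by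
  have hq := tq_ne
  simp only [Module.End.mul_apply, LinearMap.sub_apply, LinearMap.smul_apply]
  rw [oP_bv,
    S6_bv p1 p2 p3 _ (f p2 + f p3 + 1 + 1)
      (by rw [Function.update_self, Function.update_of_ne h23.symm]; omega),
    S6_bv p1 p2 p3 f (f p2 + f p3 + 1) (Nat.lt_succ_self _)]
  simp only [Function.update_self, Function.update_of_ne h12, Function.update_of_ne h23.symm,
    upd3_of_upd2 h12]
  simp only [map_sum, map_smul, oP_bv, oK_bv, upd3_1 h12 h13, upd3_2 h23, upd3_3,
    upd3_upd1 h12 h13, upd3_upd2 h23, upd3_upd3, Finset.smul_sum, smul_smul, h1]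
  generalize f p2 = j
  generalize f p3 = k
  have ext1 : ∀ g : ℕ → W6, ∑ b ∈ Finset.range (j + k + 1), (Dc b 0 j k) • g b
      = ∑ b ∈ Finset.range (j + k + 1 + 1), Dc b 0 j k • g b := by
    intro g
    rw [Finset.sum_range_succ _ (j + k + 1), Dc_zero2 (j + k + 1) _ _ _ (by omega)]; simp
  rw [ext1, Finset.sum_range_succ' _ (j + k + 1), Finset.sum_range_succ' _ (j + k + 1), add_sub_right_comm,
    ← Finset.sum_sub_distrib]
  congr 1
  · refine Finset.sum_congr rfl fun b _ => ?_
    have hr := Dc_j_rec b j k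
    by_cases hb1 : b ≤ j
    · have e1 : 0 + (j + 1) - (b + 1) = 0 + j - b := by omega
      have e3 : j + 1 + k - (b + 1) = j + k - b := by omega
      rw [e1, e3]
      have e4 : ((j + k - b : ℕ) : ℤ) = (j : ℤ) + k - b := by omega
      have e6 : ((0 + j - b : ℕ) : ℤ) = (j : ℤ) - b := by omega
      rw [e4, e6]
      have z : q ^ (2 * (1 + ((j : ℤ) - b) + ((j : ℤ) + k - b)))
          = q ^ 2 * q ^ (2 * ((j : ℤ) - b)) * q ^ (2 * ((j : ℤ) + k - b)) := by
        have : q ^ 2 = q ^ (2 : ℤ) := by norm_cast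
        rw [this, ← zpow_add₀ hq, ← zpow_add₀ hq]; congr 1; ring
      rw [z] at hr
      by_cases hb3 : b + 1 ≤ j
      · have e2 : 0 + j - (b + 1) + 1 = 0 + j - b := by omega
        have e5 : j + k - (b + 1) + 1 = j + k - b := by omega
        rw [e2, e5]
        simp only [← sub_smul]
        congr 1
        rw [hr]; ring
      · rw [Dc_zero1 (b + 1) 0 j k (by omega)] at hr ⊢
        rw [zero_smul, zero_sub]
        simp only [← neg_smul]
        congr 1
        rw [hr]; ring
    · rw [Dc_zero1 (b + 1) _ _ _ (by omega), Dc_zero1 (b + 1) _ _ _ (by omega),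
        Dc_zero1 b _ _ _ (by omega)]; simp
  · have e1 : 0 + (j + 1) - 0 = 0 + j - 0 + 1 := by omega
    have e2 : j + 1 + k - 0 = j + k - 0 + 1 := by omega
    rw [e1, e2, Dc_j_rec0]

end


/-! associated forms of the relations, used for normal ordering -/

lemma asc {A : Type*} [Ring A] {a b c : A} (h : a * b = c) (x : A) :
    a * (b * x) = c * x := by rw [← mul_assoc, h]

/-- Oscillator relations. -/
structure IsOsc {k A : Type*} [Field k] [Ring A] [Algebra k A] (Q : k) (oP oM oK : Fin 6 → A) :
    Prop where
  rPK : ∀ p, oP p * oK p = Q⁻¹ • (oK p * oP p)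
  rMK : ∀ p, oM p * oK p = Q • (oK p * oM p)
  rPM : ∀ p, oP p * oM p = 1 - oK p * oK p
  rMP : ∀ p, oM p * oP p = 1 - Q ^ 2 • (oK p * oK p)
  cPP : ∀ {p r}, p ≠ r → oP r * oP p = oP p * oP r
  cPM : ∀ {p r}, p ≠ r → oP r * oM p = oM p * oP r
  cMM : ∀ {p r}, p ≠ r → oM r * oM p = oM p * oM r
  cKP : ∀ {p r}, p ≠ r → oK r * oP p = oP p * oK r
  cKM : ∀ {p r}, p ≠ r → oK r * oM p = oM p * oK r
  cKK : ∀ p r, oK r * oK p = oK p * oK r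

section
variable {k A : Type*} [Field k] [Ring A] [Algebra k A] {Q : k} {oP oM oK : Fin 6 → A}
lemma IsOsc.cMP (H : IsOsc Q oP oM oK) {p r : Fin 6} (h : p ≠ r) : oM r * oP p = oP p * oM r :=
  (H.cPM h.symm).symm
lemma IsOsc.cPK (H : IsOsc Q oP oM oK) {p r : Fin 6} (h : p ≠ r) : oP r * oK p = oK p * oP r :=
  (H.cKP h.symm).symm
lemma IsOsc.cMK (H : IsOsc Q oP oM oK) {p r : Fin 6} (h : p ≠ r) : oM r * oK p = oK p * oM r :=
  (H.cKM h.symm).symm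
end

lemma W6_osc : IsOsc (q ^ 2) oP oM oK where
  rPK := rPK
  rMK := rMK
  rPM := rPM
  rMP p := by rw [rMP, ← pow_mul]
  cPP := cPP
  cPM := cPM
  cMM := cMM
  cKP := cKP
  cKM := cKM
  cKK := cKK

/-- The quantum matrix relations which are needed below. -/
structure IsQM {k A : Type*} [Field k] [Ring A] [Algebra k A] (Q : k)
    (T : Matrix (Fin 3) (Fin 3) A) : Prop where
  r33_23 : T 2 2 * T 1 2 = Q⁻¹ • (T 1 2 * T 2 2)
  r32_23 : T 2 1 * T 1 2 = T 1 2 * T 2 1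
  r32_33 : T 2 1 * T 2 2 = Q • (T 2 2 * T 2 1)
  r22_23 : T 1 1 * T 1 2 = Q • (T 1 2 * T 1 1)
  r22_32 : T 1 1 * T 2 1 = Q • (T 2 1 * T 1 1)
  r22_33 : T 1 1 * T 2 2 = T 2 2 * T 1 1 + (Q - Q⁻¹) • (T 1 2 * T 2 1)
  r12_33 : T 0 1 * T 2 2 = T 2 2 * T 0 1 + (Q - Q⁻¹) • (T 0 2 * T 2 1)
  r12_32 : T 0 1 * T 2 1 = Q • (T 2 1 * T 0 1)
  r12_23 : T 0 1 * T 1 2 = T 1 2 * T 0 1 + (Q - Q⁻¹) • (T 0 2 * T 1 1)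
  r21_33 : T 1 0 * T 2 2 = T 2 2 * T 1 0 + (Q - Q⁻¹) • (T 1 2 * T 2 0)
  r21_23 : T 1 0 * T 1 2 = Q • (T 1 2 * T 1 0)
  r21_32 : T 1 0 * T 2 1 = T 2 1 * T 1 0 + (Q - Q⁻¹) • (T 1 1 * T 2 0)
  r11_33 : T 0 0 * T 2 2 = T 2 2 * T 0 0 + (Q - Q⁻¹) • (T 0 2 * T 2 0)
  r11_23 : T 0 0 * T 1 2 = T 1 2 * T 0 0 + (Q - Q⁻¹) • (T 0 2 * T 1 0)
  r11_32 : T 0 0 * T 2 1 = T 2 1 * T 0 0 + (Q - Q⁻¹) • (T 0 1 * T 2 0)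

/-- The quantum matrix of the word `1 2 1`. -/
def Xm {k A : Type*} [Field k] [Ring A] [Algebra k A] (Q : k) (oP oM oK : Fin 6 → A)
    (p1 p2 p3 : Fin 6) : Matrix (Fin 3) (Fin 3) A :=
  !![oM p1 * oM p3 - Q • (oK p1 * oM p2 * oK p3), oM p1 * oK p3 + oK p1 * oM p2 * oP p3,
      oK p1 * oK p2;
     -(Q • (oK p1 * oM p3)) - Q • (oP p1 * oM p2 * oK p3),
      oP p1 * oM p2 * oP p3 - Q • (oK p1 * oK p3), oP p1 * oK p2;
     Q ^ 2 • (oK p2 * oK p3), -(Q • (oK p2 * oP p3)), oP p2]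

/-- The quantum matrix of the word `2 1 2`. -/
def Ym {k A : Type*} [Field k] [Ring A] [Algebra k A] (Q : k) (oP oM oK : Fin 6 → A)
    (p1 p2 p3 : Fin 6) : Matrix (Fin 3) (Fin 3) A :=
  !![oM p2, oM p1 * oK p2, oK p1 * oK p2;
     -(Q • (oK p2 * oM p3)), oM p1 * oP p2 * oM p3 - Q • (oK p1 * oK p3),
      oK p3 * oP p1 + oK p1 * oP p2 * oM p3;
     Q ^ 2 • (oK p2 * oK p3), -(Q • (oM p1 * oP p2 * oK p3)) - Q • (oK p1 * oP p3),
      oP p1 * oP p3 - Q • (oK p1 * oK p3 * oP p2)]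

set_option maxHeartbeats 4000000 in
lemma Xm_QM {k A : Type*} [Field k] [Ring A] [Algebra k A] {Q : k} (hq : Q ≠ 0)
    {oP oM oK : Fin 6 → A} (H : IsOsc Q oP oM oK) {p1 p2 p3 : Fin 6}
    (h12 : p1 ≠ p2) (h13 : p1 ≠ p3) (h23 : p2 ≠ p3) :
    IsQM Q (Xm Q oP oM oK p1 p2 p3) := by
  constructor <;>
  · simp only [Xm, Matrix.of_apply, Matrix.cons_val', Matrix.cons_val, Matrix.cons_val_zero,
      Matrix.cons_val_one]
    try simp only [H.cPP h12, asc (H.cPP h12), H.cPP h13, asc (H.cPP h13), H.cPP h23, asc (H.cPP h23), H.cPM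
      h12, asc (H.cPM h12), H.cPM h13, asc (H.cPM h13), H.cPM h23, asc (H.cPM h23), H.cMP h12,
      asc (H.cMP h12), H.cMP h13, asc (H.cMP h13), H.cMP h23, asc (H.cMP h23), H.cMM h12, asc
      (H.cMM h12), H.cMM h13, asc (H.cMM h13), H.cMM h23, asc (H.cMM h23), H.cKP h12, asc (H.cKP
      h12), H.cKP h13, asc (H.cKP h13), H.cKP h23, asc (H.cKP h23), H.cKM h12, asc (H.cKM h12),
      H.cKM h13, asc (H.cKM h13), H.cKM h23, asc (H.cKM h23), H.cPK h12, asc (H.cPK h12), H.cPK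
      h13, asc (H.cPK h13), H.cPK h23, asc (H.cPK h23), H.cMK h12, asc (H.cMK h12), H.cMK h13,
      asc (H.cMK h13), H.cMK h23, asc (H.cMK h23), H.cKK p1 p2, asc (H.cKK p1 p2), H.cKK p1 p3,
      asc (H.cKK p1 p3), H.cKK p2 p3, asc (H.cKK p2 p3), H.rPK p1, asc (H.rPK p1), H.rPK p2, asc
      (H.rPK p2), H.rPK p3, asc (H.rPK p3), H.rMK p1, asc (H.rMK p1), H.rMK p2, asc (H.rMK p2),
      H.rMK p3, asc (H.rMK p3), H.rPM p1, asc (H.rPM p1), H.rPM p2, asc (H.rPM p2), H.rPM p3,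
      asc (H.rPM p3), H.rMP p1, asc (H.rMP p1), H.rMP p2, asc (H.rMP p2), H.rMP p3, asc (H.rMP
      p3), mul_assoc, mul_add, add_mul, mul_sub, sub_mul, neg_mul, mul_neg, smul_add, smul_sub,
      smul_neg, neg_neg, smul_mul_assoc, mul_smul_comm, smul_smul, mul_one, one_mul]
    try (match_scalars <;> field_simp <;> ring)

set_option maxHeartbeats 4000000 in
lemma Ym_QM {k A : Type*} [Field k] [Ring A] [Algebra k A] {Q : k} (hq : Q ≠ 0)
    {oP oM oK : Fin 6 → A} (H : IsOsc Q oP oM oK) {p1 p2 p3 : Fin 6}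
    (h12 : p1 ≠ p2) (h13 : p1 ≠ p3) (h23 : p2 ≠ p3) :
    IsQM Q (Ym Q oP oM oK p1 p2 p3) := by
  constructor <;>
  · simp only [Ym, Matrix.of_apply, Matrix.cons_val', Matrix.cons_val, Matrix.cons_val_zero,
      Matrix.cons_val_one]
    try simp only [H.cPP h12, asc (H.cPP h12), H.cPP h13, asc (H.cPP h13), H.cPP h23, asc (H.cPP h23), H.cPM
      h12, asc (H.cPM h12), H.cPM h13, asc (H.cPM h13), H.cPM h23, asc (H.cPM h23), H.cMP h12,
      asc (H.cMP h12), H.cMP h13, asc (H.cMP h13), H.cMP h23, asc (H.cMP h23), H.cMM h12, asc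
      (H.cMM h12), H.cMM h13, asc (H.cMM h13), H.cMM h23, asc (H.cMM h23), H.cKP h12, asc (H.cKP
      h12), H.cKP h13, asc (H.cKP h13), H.cKP h23, asc (H.cKP h23), H.cKM h12, asc (H.cKM h12),
      H.cKM h13, asc (H.cKM h13), H.cKM h23, asc (H.cKM h23), H.cPK h12, asc (H.cPK h12), H.cPK
      h13, asc (H.cPK h13), H.cPK h23, asc (H.cPK h23), H.cMK h12, asc (H.cMK h12), H.cMK h13,
      asc (H.cMK h13), H.cMK h23, asc (H.cMK h23), H.cKK p1 p2, asc (H.cKK p1 p2), H.cKK p1 p3,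
      asc (H.cKK p1 p3), H.cKK p2 p3, asc (H.cKK p2 p3), H.rPK p1, asc (H.rPK p1), H.rPK p2, asc
      (H.rPK p2), H.rPK p3, asc (H.rPK p3), H.rMK p1, asc (H.rMK p1), H.rMK p2, asc (H.rMK p2),
      H.rMK p3, asc (H.rMK p3), H.rPM p1, asc (H.rPM p1), H.rPM p2, asc (H.rPM p2), H.rPM p3,
      asc (H.rPM p3), H.rMP p1, asc (H.rMP p1), H.rMP p2, asc (H.rMP p2), H.rMP p3, asc (H.rMP
      p3), mul_assoc, mul_add, add_mul, mul_sub, sub_mul, neg_mul, mul_neg, smul_add, smul_sub,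
      smul_neg, neg_neg, smul_mul_assoc, mul_smul_comm, smul_smul, mul_one, one_mul]
    try (match_scalars <;> field_simp <;> ring)


/-! ### Intertwining relations for `S6` -/

section
variable {k A : Type*} [Field k] [Ring A] [Algebra k A]

lemma step1 (S xt xg yt yg : A) (c : k) (hg : S * xg = yg * S)
    (hx : xt * xg = c • (xg * xt)) (hy : yt * yg = c • (yg * yt)) :
    (S * xt - yt * S) * xg = (c • yg) * (S * xt - yt * S) := by
  have e1 : S * xt * xg = c • (yg * (S * xt)) := by
    rw [mul_assoc, hx, mul_smul_comm, ← mul_assoc, hg, mul_assoc]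
  have e2 : yt * S * xg = c • (yg * (yt * S)) := by
    rw [mul_assoc, hg, ← mul_assoc, hy, smul_mul_assoc, mul_assoc]
  rw [sub_mul, e1, e2, smul_mul_assoc, mul_sub, smul_sub]

lemma step2 (S xt xg yt yg xu xw yu yw : A) (d : k) (hg : S * xg = yg * S)
    (hu : S * xu = yu * S) (hw : S * xw = yw * S)
    (hx : xt * xg = xg * xt + d • (xu * xw)) (hy : yt * yg = yg * yt + d • (yu * yw)) :
    (S * xt - yt * S) * xg = yg * (S * xt - yt * S) := by
  have e0 : S * (xu * xw) = yu * yw * S := by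
    rw [← mul_assoc, hu, mul_assoc, hw, mul_assoc]
  have e1 : S * xt * xg = yg * (S * xt) + d • (yu * yw * S) := by
    rw [mul_assoc, hx, mul_add, mul_smul_comm, e0, ← mul_assoc, hg, mul_assoc]
  have e2 : yt * S * xg = yg * (yt * S) + d • (yu * yw * S) := by
    rw [mul_assoc, hg, ← mul_assoc, hy, add_mul, smul_mul_assoc, mul_assoc]
  rw [sub_mul, e1, e2, mul_sub]
  abel
end

section
variable {p1 p2 p3 : Fin 6}

lemma gen1 (h12 : p1 ≠ p2) (T B : Module.End Fq W6)
    (hB : T * (oP p1 * oK p2) = B * T) (h0 : ∀ f : Fin 6 → ℕ, f p1 = 0 → T (bv f) = 0) : T = 0 := by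
  have key : ∀ n, ∀ f : Fin 6 → ℕ, f p1 = n → T (bv f) = 0 := by
    intro n
    induction n with
    | zero => exact h0
    | succ n ih =>
      intro f hf
      have hg := ih (Function.update f p1 n) (by simp)
      have h := congrArg (fun Z : Module.End Fq W6 => Z (bv (Function.update f p1 n))) hB
      simp only [Module.End.mul_apply, hg, map_zero, oK_bv, map_smul, oP_bv,
        Function.update_self, Function.update_idem] at h
      rw [← hf, Function.update_eq_self] at h
      exact (smul_eq_zero.mp h).resolve_left (zpow_ne_zero _ tq_ne)
  exact end_ext fun f => by rw [key _ f rfl]; rfl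

lemma gen2 (h12 : p1 ≠ p2) (T B B' : Module.End Fq W6)
    (hB : T * (oP p1 * oK p2) = B * T) (hB' : T * oP p2 = B' * T)
    (h0 : ∀ f : Fin 6 → ℕ, f p1 = 0 → f p2 = 0 → T (bv f) = 0) : T = 0 := by
  refine gen1 h12 T B hB ?_
  have key : ∀ n, ∀ f : Fin 6 → ℕ, f p1 = 0 → f p2 = n → T (bv f) = 0 := by
    intro n
    induction n with
    | zero => exact h0
    | succ n ih =>
      intro f hf1 hf
      have hg := ih (Function.update f p2 n) (by rw [Function.update_of_ne h12, hf1]) (by simp)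
      have h := congrArg (fun Z : Module.End Fq W6 => Z (bv (Function.update f p2 n))) hB'
      simp only [Module.End.mul_apply, hg, map_zero, oP_bv,
        Function.update_self, Function.update_idem] at h
      rw [← hf, Function.update_eq_self] at h
      exact h
  exact fun f hf => key _ f hf rfl

lemma gen3 (h12 : p1 ≠ p2) (h13 : p1 ≠ p3) (h23 : p2 ≠ p3) (T B B' B'' : Module.End Fq W6)
    (hB : T * (oP p1 * oK p2) = B * T) (hB' : T * oP p2 = B' * T)
    (hB'' : T * -(q ^ 2 • (oK p2 * oP p3)) = B'' * T)
    (h0 : ∀ f : Fin 6 → ℕ, f p1 = 0 → f p2 = 0 → f p3 = 0 → T (bv f) = 0) : T = 0 := by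
  refine gen2 h12 T B B' hB hB' ?_
  have key : ∀ n, ∀ f : Fin 6 → ℕ, f p1 = 0 → f p2 = 0 → f p3 = n → T (bv f) = 0 := by
    intro n
    induction n with
    | zero => exact h0
    | succ n ih =>
      intro f hf1 hf2 hf
      have hg := ih (Function.update f p3 n) (by rw [Function.update_of_ne h13, hf1])
        (by rw [Function.update_of_ne h23, hf2]) (by simp)
      have h := congrArg (fun Z : Module.End Fq W6 => Z (bv (Function.update f p3 n))) hB''
      simp only [Module.End.mul_apply, LinearMap.neg_apply, LinearMap.smul_apply, hg, map_zero,
        oP_bv, Function.update_self, Function.update_idem] at h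
      rw [← hf, Function.update_eq_self, oK_bv0 _ _ hf2, map_neg, map_smul, neg_eq_zero] at h
      exact (smul_eq_zero.mp h).resolve_left (pow_ne_zero _ tq_ne)
  exact fun f hf hf2 => key _ f hf hf2 rfl

/-- `S` intertwines the two quantum matrices. -/
lemma S6_intertwine (h12 : p1 ≠ p2) (h13 : p1 ≠ p3) (h23 : p2 ≠ p3) (a b : Fin 3) :
    S6 p1 p2 p3 * Xm (q ^ 2) oP oM oK p1 p2 p3 a b
      = Ym (q ^ 2) oP oM oK p1 p2 p3 a b * S6 p1 p2 p3 := by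
  have hq := tq_ne
  have hx := Xm_QM (pow_ne_zero 2 hq) W6_osc h12 h13 h23
  have hy := Ym_QM (pow_ne_zero 2 hq) W6_osc h12 h13 h23
  set X := Xm (q ^ 2) oP oM oK p1 p2 p3 with hX
  set Y := Ym (q ^ 2) oP oM oK p1 p2 p3 with hY
  set S : Module.End Fq W6 := S6 p1 p2 p3 with hS
  have x00 : X 0 0 = oM p1 * oM p3 - q ^ 2 • (oK p1 * oM p2 * oK p3) := rfl
  have x01 : X 0 1 = oM p1 * oK p3 + oK p1 * oM p2 * oP p3 := rfl
  have x02 : X 0 2 = oK p1 * oK p2 := rfl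
  have x10 : X 1 0 = -(q ^ 2 • (oK p1 * oM p3)) - q ^ 2 • (oP p1 * oM p2 * oK p3) := rfl
  have x11 : X 1 1 = oP p1 * oM p2 * oP p3 - q ^ 2 • (oK p1 * oK p3) := rfl
  have x12 : X 1 2 = oP p1 * oK p2 := rfl
  have x20 : X 2 0 = (q ^ 2) ^ 2 • (oK p2 * oK p3) := rfl
  have x21 : X 2 1 = -(q ^ 2 • (oK p2 * oP p3)) := rfl
  have x22 : X 2 2 = oP p2 := rfl
  have y00 : Y 0 0 = oM p2 := rfl
  have y01 : Y 0 1 = oM p1 * oK p2 := rfl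
  have y02 : Y 0 2 = oK p1 * oK p2 := rfl
  have y10 : Y 1 0 = -(q ^ 2 • (oK p2 * oM p3)) := rfl
  have y11 : Y 1 1 = oM p1 * oP p2 * oM p3 - q ^ 2 • (oK p1 * oK p3) := rfl
  have y12 : Y 1 2 = oK p3 * oP p1 + oK p1 * oP p2 * oM p3 := rfl
  have y20 : Y 2 0 = (q ^ 2) ^ 2 • (oK p2 * oK p3) := rfl
  have y21 : Y 2 1 = -(q ^ 2 • (oM p1 * oP p2 * oK p3)) - q ^ 2 • (oK p1 * oP p3) := rfl
  have y22 : Y 2 2 = oP p1 * oP p3 - q ^ 2 • (oK p1 * oK p3 * oP p2) := rfl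
  clear_value X Y
  have vac : ∀ f : Fin 6 → ℕ, f p1 = 0 → f p2 = 0 → S (bv f) = bv f :=
    fun f h1 h2 => S6_vac h12 f h1 h2
  have i02 : S * X 0 2 = Y 0 2 * S := by rw [x02, y02]; exact S6_KK12 h12 h13 h23
  have i20 : S * X 2 0 = Y 2 0 * S := by
    rw [x20, y20, mul_smul_comm, smul_mul_assoc, S6_KK23 h23]
  have i12 : S * X 1 2 = Y 1 2 * S := by rw [x12, y12]; exact S6_X23 h12 h13 h23
  have i22 : S * X 2 2 = Y 2 2 * S := by
    refine sub_eq_zero.mp (gen1 h12 _ ((q ^ 2)⁻¹ • Y 1 2) ?_ ?_)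
    · rw [← x12]; exact step1 _ _ _ _ _ _ i12 hx.r33_23 hy.r33_23
    · intro f hf
      have := S6_X33_base h12 h13 h23 f hf
      rw [LinearMap.sub_apply, x22, y22, this, sub_self]
  have i21 : S * X 2 1 = Y 2 1 * S := by
    refine sub_eq_zero.mp (gen2 h12 _ ((1 : Fq) • Y 1 2) (q ^ 2 • Y 2 2) ?_ ?_ ?_)
    · rw [← x12]
      refine step1 (A := Module.End Fq W6) _ _ _ _ _ _ i12 ?_ ?_
      · rw [one_smul, hx.r32_23]
      · rw [one_smul, hy.r32_23]
    · have := step1 _ _ _ _ _ _ i22 hx.r32_33 hy.r32_33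
      rwa [x22] at this
    · intro f h1 h2
      have e : oM p1 (oP p2 (oK p3 (bv f))) = 0 := by
        rw [oK_bv, map_smul, oP_bv, map_smul, oM_bv0, smul_zero]
        rw [Function.update_of_ne h12, h1]
      rw [x21, y21]
      simp only [Module.End.mul_apply, LinearMap.sub_apply, LinearMap.neg_apply,
        LinearMap.smul_apply, vac f h1 h2, e, map_neg, map_smul, smul_zero, neg_zero, zero_sub]
      rw [oP_bv, oK_bv0, vac, oK_bv0, sub_neg_eq_add, neg_add_cancel]
      · rw [Function.update_of_ne h13, h1]
      · rw [Function.update_of_ne h13, h1]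
      · rw [Function.update_of_ne h23, h2]
      · rw [Function.update_of_ne h23, h2]
  have i11 : S * X 1 1 = Y 1 1 * S := by
    refine sub_eq_zero.mp (gen3 h12 h13 h23 _ (q ^ 2 • Y 1 2) (Y 2 2) (q ^ 2 • Y 2 1) ?_ ?_ ?_ ?_)
    · have := step1 _ _ _ _ _ _ i12 hx.r22_23 hy.r22_23
      rwa [x12] at this
    · have := step2 _ _ _ _ _ _ _ _ _ _ i22 i12 i21 hx.r22_33 hy.r22_33
      rwa [x22] at this
    · have := step1 _ _ _ _ _ _ i21 hx.r22_32 hy.r22_32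
      rwa [x21] at this
    · intro f h1 h2 h3
      have e1 : oM p2 (oP p3 (bv f)) = 0 := by
        rw [oP_bv, oM_bv0]
        rw [Function.update_of_ne h23, h2]
      rw [x11, y11]
      simp only [Module.End.mul_apply, LinearMap.sub_apply, LinearMap.smul_apply, vac f h1 h2,
        oM_bv0 _ _ h3, oK_bv0 _ _ h3, oK_bv0 _ _ h1, map_zero, zero_sub, e1, map_neg, map_smul,
        sub_self]
  have i01 : S * X 0 1 = Y 0 1 * S := by
    refine sub_eq_zero.mp (gen3 h12 h13 h23 _ (Y 1 2) (Y 2 2) (q ^ 2 • Y 2 1) ?_ ?_ ?_ ?_)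
    · have := step2 _ _ _ _ _ _ _ _ _ _ i12 i02 i11 hx.r12_23 hy.r12_23
      rwa [x12] at this
    · have := step2 _ _ _ _ _ _ _ _ _ _ i22 i02 i21 hx.r12_33 hy.r12_33
      rwa [x22] at this
    · have := step1 _ _ _ _ _ _ i21 hx.r12_32 hy.r12_32
      rwa [x21] at this
    · intro f h1 h2 h3
      have e1 : oM p2 (oP p3 (bv f)) = 0 := by
        rw [oP_bv, oM_bv0]
        rw [Function.update_of_ne h23, h2]
      rw [x01, y01]
      simp only [Module.End.mul_apply, LinearMap.sub_apply, LinearMap.add_apply, vac f h1 h2,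
        oK_bv0 _ _ h3, oK_bv0 _ _ h2, oM_bv0 _ _ h1, map_zero, add_zero, e1, sub_self]
  have i10 : S * X 1 0 = Y 1 0 * S := by
    refine sub_eq_zero.mp (gen3 h12 h13 h23 _ (q ^ 2 • Y 1 2) (Y 2 2) (Y 2 1) ?_ ?_ ?_ ?_)
    · have := step1 _ _ _ _ _ _ i12 hx.r21_23 hy.r21_23
      rwa [x12] at this
    · have := step2 _ _ _ _ _ _ _ _ _ _ i22 i12 i20 hx.r21_33 hy.r21_33
      rwa [x22] at this
    · have := step2 _ _ _ _ _ _ _ _ _ _ i21 i11 i20 hx.r21_32 hy.r21_32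
      rwa [x21] at this
    · intro f h1 h2 h3
      rw [x10, y10]
      simp only [Module.End.mul_apply, LinearMap.sub_apply, LinearMap.neg_apply,
        LinearMap.smul_apply, vac f h1 h2,
        oK_bv0 _ _ h3, oM_bv0 _ _ h2, oM_bv0 _ _ h3, map_zero, smul_zero, neg_zero, sub_self]
  have i00 : S * X 0 0 = Y 0 0 * S := by
    refine sub_eq_zero.mp (gen3 h12 h13 h23 _ (Y 1 2) (Y 2 2) (Y 2 1) ?_ ?_ ?_ ?_)
    · have := step2 _ _ _ _ _ _ _ _ _ _ i12 i02 i10 hx.r11_23 hy.r11_23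
      rwa [x12] at this
    · have := step2 _ _ _ _ _ _ _ _ _ _ i22 i02 i20 hx.r11_33 hy.r11_33
      rwa [x22] at this
    · have := step2 _ _ _ _ _ _ _ _ _ _ i21 i01 i20 hx.r11_32 hy.r11_32
      rwa [x21] at this
    · intro f h1 h2 h3
      rw [x00, y00]
      simp only [Module.End.mul_apply, LinearMap.sub_apply, LinearMap.smul_apply, vac f h1 h2,
        oK_bv0 _ _ h3, oM_bv0 _ _ h2, oM_bv0 _ _ h3, map_zero, smul_zero, sub_self]
  fin_cases a <;> fin_cases b <;> assumption

end


/-! ### The tetrahedron equation -/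

section
variable {k A : Type*} [Field k] [Ring A] [Algebra k A]

/-- The elementary `4 × 4` matrices of oscillator operators. -/
def Lg (Q : k) (oP oM oK : Fin 6 → A) (i : Fin 3) (p : Fin 6) : Matrix (Fin 4) (Fin 4) A :=
  match i with
  | 0 => !![oM p, oK p, 0, 0; -(Q • oK p), oP p, 0, 0; 0, 0, 1, 0; 0, 0, 0, 1]
  | 1 => !![1, 0, 0, 0; 0, oM p, oK p, 0; 0, -(Q • oK p), oP p, 0; 0, 0, 0, 1]
  | 2 => !![1, 0, 0, 0; 0, 1, 0, 0; 0, 0, oM p, oK p; 0, 0, -(Q • oK p), oP p]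

/-- upper left embedding -/
def emb0 (T : Matrix (Fin 3) (Fin 3) A) : Matrix (Fin 4) (Fin 4) A :=
  !![T 0 0, T 0 1, T 0 2, 0; T 1 0, T 1 1, T 1 2, 0; T 2 0, T 2 1, T 2 2, 0; 0, 0, 0, 1]
/-- lower right embedding -/
def emb1 (T : Matrix (Fin 3) (Fin 3) A) : Matrix (Fin 4) (Fin 4) A :=
  !![1, 0, 0, 0; 0, T 0 0, T 0 1, T 0 2; 0, T 1 0, T 1 1, T 1 2; 0, T 2 0, T 2 1, T 2 2]

/-- An operator as a scalar matrix. -/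
def sc (S : A) : Matrix (Fin 4) (Fin 4) A := Matrix.diagonal fun _ => S

lemma sc_mul (S T : A) : sc (S * T) = sc S * sc T := by
  simp [sc, Matrix.diagonal_mul_diagonal]
lemma sc_mul_apply (S : A) (M : Matrix (Fin 4) (Fin 4) A) (i j : Fin 4) :
    (sc S * M) i j = S * M i j := by
  simp [sc, Matrix.diagonal_mul]
lemma mul_sc_apply (S : A) (M : Matrix (Fin 4) (Fin 4) A) (i j : Fin 4) :
    (M * sc S) i j = M i j * S := by
  simp [sc, Matrix.mul_diagonal]

lemma sc_comm_Lg (Q : k) (oP oM oK : Fin 6 → A) (S : A) (i : Fin 3) (s : Fin 6)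
    (eP : S * oP s = oP s * S) (eM : S * oM s = oM s * S) (eK : S * oK s = oK s * S) :
    sc S * Lg Q oP oM oK i s = Lg Q oP oM oK i s * sc S := by
  ext1 a b
  rw [sc_mul_apply, mul_sc_apply]
  fin_cases i <;> fin_cases a <;> fin_cases b <;> simp [Lg, eP, eM, eK]

lemma sc_emb0 (S : A) (X Y : Matrix (Fin 3) (Fin 3) A) (h : ∀ a b, S * X a b = Y a b * S) :
    sc S * emb0 X = emb0 Y * sc S := by
  ext1 a b
  rw [sc_mul_apply, mul_sc_apply]
  fin_cases a <;> fin_cases b <;> simp [emb0, h]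

lemma sc_emb1 (S : A) (X Y : Matrix (Fin 3) (Fin 3) A) (h : ∀ a b, S * X a b = Y a b * S) :
    sc S * emb1 X = emb1 Y * sc S := by
  ext1 a b
  rw [sc_mul_apply, mul_sc_apply]
  fin_cases a <;> fin_cases b <;> simp [emb1, h]

lemma Lg_comm (Q : k) (oP oM oK : Fin 6 → A) (p r : Fin 6) :
    Lg Q oP oM oK 2 r * Lg Q oP oM oK 0 p = Lg Q oP oM oK 0 p * Lg Q oP oM oK 2 r := by
  ext1 a b
  fin_cases a <;> fin_cases b <;> simp [Lg, Matrix.mul_apply, Fin.sum_univ_four]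

set_option maxHeartbeats 4000000 in
lemma Lg_Xm0 {Q : k} {oP oM oK : Fin 6 → A} (H : IsOsc Q oP oM oK) {p1 p2 p3 : Fin 6}
    (h12 : p1 ≠ p2) (h13 : p1 ≠ p3) (h23 : p2 ≠ p3) :
    Lg Q oP oM oK 0 p1 * Lg Q oP oM oK 1 p2 * Lg Q oP oM oK 0 p3
      = emb0 (Xm Q oP oM oK p1 p2 p3) := by
  ext1 a b
  fin_cases a <;> fin_cases b <;>
  · simp [Lg, Xm, emb0, Matrix.mul_apply, Fin.sum_univ_four]
    try simp only [H.cPP h12, asc (H.cPP h12), H.cPP h13, asc (H.cPP h13), H.cPP h23, asc (H.cPP h23), H.cPM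
      h12, asc (H.cPM h12), H.cPM h13, asc (H.cPM h13), H.cPM h23, asc (H.cPM h23), H.cMP h12,
      asc (H.cMP h12), H.cMP h13, asc (H.cMP h13), H.cMP h23, asc (H.cMP h23), H.cMM h12, asc
      (H.cMM h12), H.cMM h13, asc (H.cMM h13), H.cMM h23, asc (H.cMM h23), H.cKP h12, asc (H.cKP
      h12), H.cKP h13, asc (H.cKP h13), H.cKP h23, asc (H.cKP h23), H.cKM h12, asc (H.cKM h12),
      H.cKM h13, asc (H.cKM h13), H.cKM h23, asc (H.cKM h23), H.cPK h12, asc (H.cPK h12), H.cPK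
      h13, asc (H.cPK h13), H.cPK h23, asc (H.cPK h23), H.cMK h12, asc (H.cMK h12), H.cMK h13,
      asc (H.cMK h13), H.cMK h23, asc (H.cMK h23), H.cKK p1 p2, asc (H.cKK p1 p2), H.cKK p1 p3,
      asc (H.cKK p1 p3), H.cKK p2 p3, asc (H.cKK p2 p3), H.rPK p1, asc (H.rPK p1), H.rPK p2, asc
      (H.rPK p2), H.rPK p3, asc (H.rPK p3), H.rMK p1, asc (H.rMK p1), H.rMK p2, asc (H.rMK p2),
      H.rMK p3, asc (H.rMK p3), H.rPM p1, asc (H.rPM p1), H.rPM p2, asc (H.rPM p2), H.rPM p3,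
      asc (H.rPM p3), H.rMP p1, asc (H.rMP p1), H.rMP p2, asc (H.rMP p2), H.rMP p3, asc (H.rMP
      p3), mul_assoc, mul_add, add_mul, mul_sub, sub_mul, neg_mul, mul_neg, smul_add, smul_sub,
      smul_neg, neg_neg, smul_mul_assoc, mul_smul_comm, smul_smul, mul_one, one_mul]
    try (match_scalars <;> ring)

set_option maxHeartbeats 4000000 in
lemma Lg_Xm1 {Q : k} {oP oM oK : Fin 6 → A} (H : IsOsc Q oP oM oK) {p1 p2 p3 : Fin 6}
    (h12 : p1 ≠ p2) (h13 : p1 ≠ p3) (h23 : p2 ≠ p3) :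
    Lg Q oP oM oK 1 p1 * Lg Q oP oM oK 2 p2 * Lg Q oP oM oK 1 p3
      = emb1 (Xm Q oP oM oK p1 p2 p3) := by
  ext1 a b
  fin_cases a <;> fin_cases b <;>
  · simp [Lg, Xm, emb1, Matrix.mul_apply, Fin.sum_univ_four]
    try simp only [H.cPP h12, asc (H.cPP h12), H.cPP h13, asc (H.cPP h13), H.cPP h23, asc (H.cPP h23), H.cPM
      h12, asc (H.cPM h12), H.cPM h13, asc (H.cPM h13), H.cPM h23, asc (H.cPM h23), H.cMP h12,
      asc (H.cMP h12), H.cMP h13, asc (H.cMP h13), H.cMP h23, asc (H.cMP h23), H.cMM h12, asc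
      (H.cMM h12), H.cMM h13, asc (H.cMM h13), H.cMM h23, asc (H.cMM h23), H.cKP h12, asc (H.cKP
      h12), H.cKP h13, asc (H.cKP h13), H.cKP h23, asc (H.cKP h23), H.cKM h12, asc (H.cKM h12),
      H.cKM h13, asc (H.cKM h13), H.cKM h23, asc (H.cKM h23), H.cPK h12, asc (H.cPK h12), H.cPK
      h13, asc (H.cPK h13), H.cPK h23, asc (H.cPK h23), H.cMK h12, asc (H.cMK h12), H.cMK h13,
      asc (H.cMK h13), H.cMK h23, asc (H.cMK h23), H.cKK p1 p2, asc (H.cKK p1 p2), H.cKK p1 p3,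
      asc (H.cKK p1 p3), H.cKK p2 p3, asc (H.cKK p2 p3), H.rPK p1, asc (H.rPK p1), H.rPK p2, asc
      (H.rPK p2), H.rPK p3, asc (H.rPK p3), H.rMK p1, asc (H.rMK p1), H.rMK p2, asc (H.rMK p2),
      H.rMK p3, asc (H.rMK p3), H.rPM p1, asc (H.rPM p1), H.rPM p2, asc (H.rPM p2), H.rPM p3,
      asc (H.rPM p3), H.rMP p1, asc (H.rMP p1), H.rMP p2, asc (H.rMP p2), H.rMP p3, asc (H.rMP
      p3), mul_assoc, mul_add, add_mul, mul_sub, sub_mul, neg_mul, mul_neg, smul_add, smul_sub,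
      smul_neg, neg_neg, smul_mul_assoc, mul_smul_comm, smul_smul, mul_one, one_mul]
    try (match_scalars <;> ring)

set_option maxHeartbeats 4000000 in
lemma Lg_Ym0 {Q : k} {oP oM oK : Fin 6 → A} (H : IsOsc Q oP oM oK) {p1 p2 p3 : Fin 6}
    (h12 : p1 ≠ p2) (h13 : p1 ≠ p3) (h23 : p2 ≠ p3) :
    Lg Q oP oM oK 1 p3 * Lg Q oP oM oK 0 p2 * Lg Q oP oM oK 1 p1
      = emb0 (Ym Q oP oM oK p1 p2 p3) := by
  ext1 a b
  fin_cases a <;> fin_cases b <;>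
  · simp [Lg, Ym, emb0, Matrix.mul_apply, Fin.sum_univ_four]
    try simp only [H.cPP h12, asc (H.cPP h12), H.cPP h13, asc (H.cPP h13), H.cPP h23, asc (H.cPP h23), H.cPM
      h12, asc (H.cPM h12), H.cPM h13, asc (H.cPM h13), H.cPM h23, asc (H.cPM h23), H.cMP h12,
      asc (H.cMP h12), H.cMP h13, asc (H.cMP h13), H.cMP h23, asc (H.cMP h23), H.cMM h12, asc
      (H.cMM h12), H.cMM h13, asc (H.cMM h13), H.cMM h23, asc (H.cMM h23), H.cKP h12, asc (H.cKP
      h12), H.cKP h13, asc (H.cKP h13), H.cKP h23, asc (H.cKP h23), H.cKM h12, asc (H.cKM h12),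
      H.cKM h13, asc (H.cKM h13), H.cKM h23, asc (H.cKM h23), H.cPK h12, asc (H.cPK h12), H.cPK
      h13, asc (H.cPK h13), H.cPK h23, asc (H.cPK h23), H.cMK h12, asc (H.cMK h12), H.cMK h13,
      asc (H.cMK h13), H.cMK h23, asc (H.cMK h23), H.cKK p1 p2, asc (H.cKK p1 p2), H.cKK p1 p3,
      asc (H.cKK p1 p3), H.cKK p2 p3, asc (H.cKK p2 p3), H.rPK p1, asc (H.rPK p1), H.rPK p2, asc
      (H.rPK p2), H.rPK p3, asc (H.rPK p3), H.rMK p1, asc (H.rMK p1), H.rMK p2, asc (H.rMK p2),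
      H.rMK p3, asc (H.rMK p3), H.rPM p1, asc (H.rPM p1), H.rPM p2, asc (H.rPM p2), H.rPM p3,
      asc (H.rPM p3), H.rMP p1, asc (H.rMP p1), H.rMP p2, asc (H.rMP p2), H.rMP p3, asc (H.rMP
      p3), mul_assoc, mul_add, add_mul, mul_sub, sub_mul, neg_mul, mul_neg, smul_add, smul_sub,
      smul_neg, neg_neg, smul_mul_assoc, mul_smul_comm, smul_smul, mul_one, one_mul]
    try (match_scalars <;> ring)

set_option maxHeartbeats 4000000 in
lemma Lg_Ym1 {Q : k} {oP oM oK : Fin 6 → A} (H : IsOsc Q oP oM oK) {p1 p2 p3 : Fin 6}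
    (h12 : p1 ≠ p2) (h13 : p1 ≠ p3) (h23 : p2 ≠ p3) :
    Lg Q oP oM oK 2 p3 * Lg Q oP oM oK 1 p2 * Lg Q oP oM oK 2 p1
      = emb1 (Ym Q oP oM oK p1 p2 p3) := by
  ext1 a b
  fin_cases a <;> fin_cases b <;>
  · simp [Lg, Ym, emb1, Matrix.mul_apply, Fin.sum_univ_four]
    try simp only [H.cPP h12, asc (H.cPP h12), H.cPP h13, asc (H.cPP h13), H.cPP h23, asc (H.cPP h23), H.cPM
      h12, asc (H.cPM h12), H.cPM h13, asc (H.cPM h13), H.cPM h23, asc (H.cPM h23), H.cMP h12,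
      asc (H.cMP h12), H.cMP h13, asc (H.cMP h13), H.cMP h23, asc (H.cMP h23), H.cMM h12, asc
      (H.cMM h12), H.cMM h13, asc (H.cMM h13), H.cMM h23, asc (H.cMM h23), H.cKP h12, asc (H.cKP
      h12), H.cKP h13, asc (H.cKP h13), H.cKP h23, asc (H.cKP h23), H.cKM h12, asc (H.cKM h12),
      H.cKM h13, asc (H.cKM h13), H.cKM h23, asc (H.cKM h23), H.cPK h12, asc (H.cPK h12), H.cPK
      h13, asc (H.cPK h13), H.cPK h23, asc (H.cPK h23), H.cMK h12, asc (H.cMK h12), H.cMK h13,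
      asc (H.cMK h13), H.cMK h23, asc (H.cMK h23), H.cKK p1 p2, asc (H.cKK p1 p2), H.cKK p1 p3,
      asc (H.cKK p1 p3), H.cKK p2 p3, asc (H.cKK p2 p3), H.rPK p1, asc (H.rPK p1), H.rPK p2, asc
      (H.rPK p2), H.rPK p3, asc (H.rPK p3), H.rMK p1, asc (H.rMK p1), H.rMK p2, asc (H.rMK p2),
      H.rMK p3, asc (H.rMK p3), H.rPM p1, asc (H.rPM p1), H.rPM p2, asc (H.rPM p2), H.rPM p3,
      asc (H.rPM p3), H.rMP p1, asc (H.rMP p1), H.rMP p2, asc (H.rMP p2), H.rMP p3, asc (H.rMP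
      p3), mul_assoc, mul_add, add_mul, mul_sub, sub_mul, neg_mul, mul_neg, smul_add, smul_sub,
      smul_neg, neg_neg, smul_mul_assoc, mul_smul_comm, smul_smul, mul_one, one_mul]
    try (match_scalars <;> ring)

end


section
variable {M : Type*} [Monoid M]

/-- The data used to derive the intertwining property of both sides for the six-letter words. -/
structure TEData (L : Fin 3 → Fin 6 → M) (S : Fin 6 → Fin 6 → Fin 6 → M) : Prop where
  cc : ∀ p r, L 2 r * L 0 p = L 0 p * L 2 r
  cs : ∀ p1 p2 p3 s i, s ≠ p1 → s ≠ p2 → s ≠ p3 → S p1 p2 p3 * L i s = L i s * S p1 p2 p3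
  r0 : ∀ p1 p2 p3, p1 ≠ p2 → p1 ≠ p3 → p2 ≠ p3 →
    S p1 p2 p3 * (L 0 p1 * L 1 p2 * L 0 p3) = L 1 p3 * L 0 p2 * L 1 p1 * S p1 p2 p3
  r1 : ∀ p1 p2 p3, p1 ≠ p2 → p1 ≠ p3 → p2 ≠ p3 →
    S p1 p2 p3 * (L 1 p1 * L 2 p2 * L 1 p3) = L 2 p3 * L 1 p2 * L 2 p1 * S p1 p2 p3

variable {L : Fin 3 → Fin 6 → M} {S : Fin 6 → Fin 6 → Fin 6 → M}

lemma TEData.r0' (H : TEData L S) {p1 p2 p3 : Fin 6} (h12 : p1 ≠ p2) (h13 : p1 ≠ p3)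
    (h23 : p2 ≠ p3) (t : M) :
    S p1 p2 p3 * (L 0 p1 * (L 1 p2 * (L 0 p3 * t)))
      = L 1 p3 * (L 0 p2 * (L 1 p1 * (S p1 p2 p3 * t))) := by
  have := congrArg (· * t) (H.r0 p1 p2 p3 h12 h13 h23)
  simpa only [mul_assoc] using this

lemma TEData.r1' (H : TEData L S) {p1 p2 p3 : Fin 6} (h12 : p1 ≠ p2) (h13 : p1 ≠ p3)
    (h23 : p2 ≠ p3) (t : M) :
    S p1 p2 p3 * (L 1 p1 * (L 2 p2 * (L 1 p3 * t)))
      = L 2 p3 * (L 1 p2 * (L 2 p1 * (S p1 p2 p3 * t))) := by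
  have := congrArg (· * t) (H.r1 p1 p2 p3 h12 h13 h23)
  simpa only [mul_assoc] using this

lemma TEData.cs' (H : TEData L S) {p1 p2 p3 s : Fin 6} (i : Fin 3) (h1 : s ≠ p1) (h2 : s ≠ p2)
    (h3 : s ≠ p3) (t : M) : S p1 p2 p3 * (L i s * t) = L i s * (S p1 p2 p3 * t) := by
  rw [← mul_assoc, H.cs _ _ _ _ _ h1 h2 h3, mul_assoc]

lemma TEData.cc' (H : TEData L S) (p r : Fin 6) (t : M) :
    L 2 r * (L 0 p * t) = L 0 p * (L 2 r * t) := by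
  rw [← mul_assoc, H.cc, mul_assoc]

lemma TEData.left (H : TEData L S) :
    S 2 4 5 * (S 1 3 5 * (S 0 3 4 * (S 0 1 2 *
      (L 0 0 * (L 1 1 * (L 0 2 * (L 2 3 * (L 1 4 * (L 0 5 * 1)))))))))
    = L 2 5 * (L 1 4 * (L 2 2 * (L 0 3 * (L 1 1 * (L 2 0 *
        (S 2 4 5 * (S 1 3 5 * (S 0 3 4 * (S 0 1 2 * 1))))))))) := by
  rw [H.r0' (by decide) (by decide) (by decide),
    H.cs' 2 (s := 3) (by decide) (by decide) (by decide),
    H.cs' 1 (s := 4) (by decide) (by decide) (by decide),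
    H.cs' 0 (s := 5) (by decide) (by decide) (by decide),
    H.cs' 1 (s := 2) (by decide) (by decide) (by decide),
    H.cs' 0 (s := 1) (by decide) (by decide) (by decide),
    H.r1' (by decide) (by decide) (by decide),
    H.cs' 0 (s := 5) (by decide) (by decide) (by decide),
    ← H.cc', H.cc' 5 0,
    H.cs' 1 (s := 2) (by decide) (by decide) (by decide),
    H.cs' 2 (s := 4) (by decide) (by decide) (by decide),
    H.r0' (by decide) (by decide) (by decide),
    H.cs' 2 (s := 0) (by decide) (by decide) (by decide),
    H.r1' (by decide) (by decide) (by decide),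
    H.cs' 0 (s := 3) (by decide) (by decide) (by decide),
    H.cs' 1 (s := 1) (by decide) (by decide) (by decide),
    H.cs' 2 (s := 0) (by decide) (by decide) (by decide)]

lemma TEData.right (H : TEData L S) :
    S 0 1 2 * (S 0 3 4 * (S 1 3 5 * (S 2 4 5 *
      (L 0 0 * (L 1 1 * (L 0 2 * (L 2 3 * (L 1 4 * (L 0 5 * 1)))))))))
    = L 2 5 * (L 1 4 * (L 2 2 * (L 0 3 * (L 1 1 * (L 2 0 *
        (S 0 1 2 * (S 0 3 4 * (S 1 3 5 * (S 2 4 5 * 1))))))))) := by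
  rw [← H.cc' 2 3,
    H.cs' 0 (s := 0) (by decide) (by decide) (by decide),
    H.cs' 1 (s := 1) (by decide) (by decide) (by decide),
    H.cs' 2 (s := 3) (by decide) (by decide) (by decide),
    H.r0' (by decide) (by decide) (by decide),
    H.cs' 0 (s := 0) (by decide) (by decide) (by decide),
    H.r1' (by decide) (by decide) (by decide),
    H.cs' 0 (s := 4) (by decide) (by decide) (by decide),
    H.cs' 1 (s := 2) (by decide) (by decide) (by decide),
    ← H.cc' 0 5, H.cc' 4 1,
    H.cs' 2 (s := 5) (by decide) (by decide) (by decide),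
    H.r0' (by decide) (by decide) (by decide),
    H.cs' 2 (s := 1) (by decide) (by decide) (by decide),
    H.cs' 1 (s := 2) (by decide) (by decide) (by decide),
    H.cs' 2 (s := 5) (by decide) (by decide) (by decide),
    H.cs' 1 (s := 4) (by decide) (by decide) (by decide),
    H.cs' 0 (s := 3) (by decide) (by decide) (by decide),
    H.r1' (by decide) (by decide) (by decide), ← H.cc' 3 2]

end

lemma te_data : TEData (M := Matrix (Fin 4) (Fin 4) (Module.End Fq W6))
    (fun i p => Lg (q ^ 2) oP oM oK i p) (fun a b c => sc (S6 a b c : Module.End Fq W6)) where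
  cc p r := Lg_comm _ _ _ _ _ _
  cs p1 p2 p3 s i h1 h2 h3 := sc_comm_Lg _ _ _ _ _ _ _ (S6_comm_P s h1 h2 h3)
    (S6_comm_M s h1 h2 h3) (S6_comm_K s h1 h2 h3)
  r0 p1 p2 p3 h12 h13 h23 := by
    rw [Lg_Xm0 W6_osc h12 h13 h23, Lg_Ym0 W6_osc h12 h13 h23]
    exact sc_emb0 _ _ _ (S6_intertwine h12 h13 h23)
  r1 p1 p2 p3 h12 h13 h23 := by
    rw [Lg_Xm1 W6_osc h12 h13 h23, Lg_Ym1 W6_osc h12 h13 h23]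
    exact sc_emb1 _ _ _ (S6_intertwine h12 h13 h23)

/-- The six-letter word of L-operators. -/
def XX {k A : Type*} [Field k] [Ring A] [Algebra k A] (Q : k) (oP oM oK : Fin 6 → A) :
    Matrix (Fin 4) (Fin 4) A :=
  Lg Q oP oM oK 0 0 * (Lg Q oP oM oK 1 1 * (Lg Q oP oM oK 0 2 * (Lg Q oP oM oK 2 3 *
    (Lg Q oP oM oK 1 4 * (Lg Q oP oM oK 0 5 * 1)))))

section
variable {k A : Type*} [Field k] [Ring A] [Algebra k A] (Q : k) (oP oM oK : Fin 6 → A)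
lemma XX33 : XX Q oP oM oK 3 3 = oP 3 := by
  simp [XX, Lg, Matrix.mul_apply, Fin.sum_univ_four]
lemma XX23 : XX Q oP oM oK 2 3 = oP 1 * oK 3 := by
  simp [XX, Lg, Matrix.mul_apply, Fin.sum_univ_four]
lemma XX13 : XX Q oP oM oK 1 3 = oP 0 * (oK 1 * oK 3) := by
  simp [XX, Lg, Matrix.mul_apply, Fin.sum_univ_four]
lemma XX32 : XX Q oP oM oK 3 2 = -(Q • (oK 3 * oP 4)) := by
  simp [XX, Lg, Matrix.mul_apply, Fin.sum_univ_four]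
lemma XX31 : XX Q oP oM oK 3 1 = Q • Q • (oK 3 * (oK 4 * oP 5)) := by
  simp [XX, Lg, Matrix.mul_apply, Fin.sum_univ_four]
lemma XX22 : XX Q oP oM oK 2 2 = -(Q • (oK 1 * (oP 2 * oK 4))) + oP 1 * (oM 3 * oP 4) := by
  simp [XX, Lg, Matrix.mul_apply, Fin.sum_univ_four]
end

section
variable {A : Type*} [Ring A]
lemma entries_aux {s1 s2 s3 s4 : A} {X Y1 Y2 Y3 Y4 Y5 Y6 : Matrix (Fin 4) (Fin 4) A}
    (h : sc s1 * (sc s2 * (sc s3 * (sc s4 * X)))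
      = Y1 * (Y2 * (Y3 * (Y4 * (Y5 * (Y6 * (sc s1 * (sc s2 * (sc s3 * (sc s4 * 1)))))))))) (a b) :
    s1 * (s2 * (s3 * s4)) * X a b
      = (Y1 * (Y2 * (Y3 * (Y4 * (Y5 * Y6))))) a b * (s1 * (s2 * (s3 * s4))) := by
  rw [← mul_sc_apply, ← sc_mul_apply]
  simp only [sc_mul, mul_assoc, mul_one] at h ⊢
  rw [h]

lemma entries_sub {s t x y : A} (h : s * x = y * s) (h' : t * x = y * t) :
    (s - t) * x = y * (s - t) := by
  rw [sub_mul, mul_sub, h, h']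
end

/-- The difference of both sides of the tetrahedron equation. -/
def DD : Module.End Fq W6 :=
  (S6 2 4 5 * (S6 1 3 5 * (S6 0 3 4 * S6 0 1 2)) : Module.End Fq W6)
      - (S6 0 1 2 * (S6 0 3 4 * (S6 1 3 5 * S6 2 4 5)) : Module.End Fq W6)

lemma te_entries (a b : Fin 4) : ∃ y : Module.End Fq W6, DD * XX (q ^ 2) oP oM oK a b = y * DD :=
  ⟨_, entries_sub (entries_aux te_data.left a b) (entries_aux te_data.right a b)⟩

lemma DD_vac : DD (bv 0) = 0 := by
  unfold DD
  rw [LinearMap.sub_apply]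
  simp only [Module.End.mul_apply]
  rw [S6_vac (p1 := 0) (p2 := 1) (p3 := 2) (by decide) 0 rfl rfl,
    S6_vac (p1 := 0) (p2 := 3) (p3 := 4) (by decide) 0 rfl rfl,
    S6_vac (p1 := 1) (p2 := 3) (p3 := 5) (by decide) 0 rfl rfl,
    S6_vac (p1 := 2) (p2 := 4) (p3 := 5) (by decide) 0 rfl rfl,
    S6_vac (p1 := 1) (p2 := 3) (p3 := 5) (by decide) 0 rfl rfl,
    S6_vac (p1 := 0) (p2 := 3) (p3 := 4) (by decide) 0 rfl rfl,
    S6_vac (p1 := 0) (p2 := 1) (p3 := 2) (by decide) 0 rfl rfl, sub_self]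

/-- One step of the induction: raising coordinate `p` with an entry of the word. -/
lemma DD_up (x : Module.End Fq W6) (hx : ∃ y : Module.End Fq W6, DD * x = y * DD)
    (p : Fin 6) (C : (Fin 6 → ℕ) → Prop) (hC : ∀ f n, C f → C (Function.update f p n))
    (hact : ∀ f, C f → ∃ c : Fq, c ≠ 0 ∧ x (bv f) = c • bv (Function.update f p (f p + 1)))
    (h0 : ∀ f, C f → f p = 0 → DD (bv f) = 0) : ∀ f, C f → DD (bv f) = 0 := by
  have key : ∀ n, ∀ f, C f → f p = n → DD (bv f) = 0 := by
    intro n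
    induction n with
    | zero => exact h0
    | succ n ih =>
      intro f hf hn
      have hg := ih (Function.update f p n) (hC f n hf) (by simp)
      obtain ⟨y, hy⟩ := hx
      obtain ⟨c, hc, e⟩ := hact _ (hC f n hf)
      have h := congrArg (fun Z : Module.End Fq W6 => Z (bv (Function.update f p n))) hy
      simp only [Module.End.mul_apply, hg, map_zero, e, map_smul, Function.update_self,
        Function.update_idem] at h
      rw [← hn, Function.update_eq_self] at h
      exact (smul_eq_zero.mp h).resolve_left hc
  exact fun f hf => key _ f hf rfl

lemma DD_zero : DD = 0 := by
  have hz : ∀ n : ℤ, q ^ n ≠ 0 := fun n => zpow_ne_zero _ tq_ne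
  have hq2 : q ^ 2 ≠ 0 := pow_ne_zero _ tq_ne
  have u : ∀ (f : Fin 6 → ℕ) (p r : Fin 6) (n : ℕ), r ≠ p → Function.update f p n r = f r :=
    fun f p r n h => Function.update_of_ne h _ _
  have s2 : ∀ f : Fin 6 → ℕ, (f 0 = 0 ∧ f 1 = 0 ∧ f 3 = 0 ∧ f 4 = 0 ∧ f 5 = 0) →
      DD (bv f) = 0 := by
    refine DD_up _ (te_entries 2 2) 2 _ ?_ ?_ ?_
    · rintro f n ⟨h0, h1, h3, h4, h5⟩
      simp [h0, h1, h3, h4, h5]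
    · rintro f ⟨h0, h1, h3, h4, h5⟩
      refine ⟨-(q ^ 2), neg_ne_zero.mpr hq2, ?_⟩
      rw [XX22]
      simp only [LinearMap.add_apply, LinearMap.neg_apply, LinearMap.smul_apply,
        Module.End.mul_apply]
      rw [oK_bv0 4 f h4, oP_bv, oK_bv0 1 _ (by rw [u _ _ _ _ (by decide), h1]), oP_bv,
        oM_bv0 3 _ (by rw [u _ _ _ _ (by decide), h3]), map_zero, add_zero, neg_smul]
    · rintro f ⟨h0, h1, h3, h4, h5⟩ h2
      have : f = 0 := by
        ext i; fin_cases i <;> simp [h0, h1, h2, h3, h4, h5]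
      rw [this, DD_vac]
  have s3 : ∀ f : Fin 6 → ℕ, (f 0 = 0 ∧ f 1 = 0 ∧ f 4 = 0 ∧ f 5 = 0) → DD (bv f) = 0 := by
    refine DD_up _ (te_entries 3 3) 3 _ ?_ ?_ ?_
    · rintro f n ⟨h0, h1, h4, h5⟩
      simp [h0, h1, h4, h5]
    · rintro f -
      exact ⟨1, one_ne_zero, by rw [XX33, oP_bv, one_smul]⟩
    · rintro f ⟨h0, h1, h4, h5⟩ h3
      exact s2 f ⟨h0, h1, h3, h4, h5⟩
  have s1 : ∀ f : Fin 6 → ℕ, (f 0 = 0 ∧ f 4 = 0 ∧ f 5 = 0) → DD (bv f) = 0 := by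
    refine DD_up _ (te_entries 2 3) 1 _ ?_ ?_ ?_
    · rintro f n ⟨h0, h4, h5⟩
      simp [h0, h4, h5]
    · rintro f -
      refine ⟨_, hz (2 * (f 3 : ℤ)), ?_⟩
      rw [XX23, Module.End.mul_apply, oK_bv, map_smul, oP_bv]
    · rintro f ⟨h0, h4, h5⟩ h1
      exact s3 f ⟨h0, h1, h4, h5⟩
  have s0 : ∀ f : Fin 6 → ℕ, (f 4 = 0 ∧ f 5 = 0) → DD (bv f) = 0 := by
    refine DD_up _ (te_entries 1 3) 0 _ ?_ ?_ ?_
    · rintro f n ⟨h4, h5⟩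
      simp [h4, h5]
    · rintro f -
      refine ⟨_, mul_ne_zero (hz (2 * (f 3 : ℤ))) (hz (2 * (f 1 : ℤ))), ?_⟩
      rw [XX13, Module.End.mul_apply, Module.End.mul_apply, oK_bv, map_smul, oK_bv, smul_smul,
        map_smul, oP_bv]
    · rintro f ⟨h4, h5⟩ h0
      exact s1 f ⟨h0, h4, h5⟩
  have s4 : ∀ f : Fin 6 → ℕ, (f 5 = 0) → DD (bv f) = 0 := by
    refine DD_up _ (te_entries 3 2) 4 _ ?_ ?_ ?_
    · intro f n h5
      simp [h5]
    · rintro f -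
      refine ⟨_, neg_ne_zero.mpr (mul_ne_zero hq2 (hz (2 * (f 3 : ℤ)))), ?_⟩
      rw [XX32, LinearMap.neg_apply, LinearMap.smul_apply, Module.End.mul_apply, oP_bv, oK_bv,
        smul_smul, neg_smul, u _ _ _ _ (by decide)]
    · exact fun f h5 h4 => s0 f ⟨h4, h5⟩
  have s5 : ∀ f : Fin 6 → ℕ, True → DD (bv f) = 0 := by
    refine DD_up _ (te_entries 3 1) 5 _ (fun _ _ _ => trivial) ?_ (fun f _ h => s4 f h)
    rintro f -
    refine ⟨_, mul_ne_zero hq2 (mul_ne_zero hq2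
      (mul_ne_zero (hz (2 * (f 4 : ℤ))) (hz (2 * (f 3 : ℤ))))), ?_⟩
    rw [XX31, LinearMap.smul_apply, LinearMap.smul_apply, Module.End.mul_apply,
      Module.End.mul_apply, oP_bv, oK_bv, map_smul, oK_bv,
      u _ _ 4 _ (by decide), u _ _ 3 _ (by decide)]
    simp only [smul_smul]
  exact end_ext fun f => by rw [s5 f trivial]; rfl


/-- the Zamolodchikov tetrahedron equation
𝒮₃₅₆ 𝒮₂₄₆ 𝒮₁₄₅ 𝒮₁₂₃ = 𝒮₁₂₃ 𝒮₁₄₅ 𝒮₂₄₆ 𝒮₃₅₆ on F^{⊗6} (positions written 0-based). -/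
theorem tetrahedron_equation :
    S6 2 4 5 ∘ₗ S6 1 3 5 ∘ₗ S6 0 3 4 ∘ₗ S6 0 1 2
      = S6 0 1 2 ∘ₗ S6 0 3 4 ∘ₗ S6 1 3 5 ∘ₗ S6 2 4 5 := by
  exact sub_eq_zero.mp DD_zero
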